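/- Assume G is a good normal subgroup of W~. For every H~ in A'(W~) there exists a unique reflecting hyperplane φ(H~) of W in V containing p(H~); the map φ factors through A'bar(W~) and induces a bijection from A'bar(W~) onto the set A(W) of reflecting hyperplanes of W in V. Moreover, for every H in A(W) there is a linear form α_H in A = k[V] defining H whose image in A/I = B^G equals alpha_{φ^{-1}(H)}, and the algebra B^G is generated by B^{W~} together with the elements alpha_{φ^{-1}(H)} for H in A(W), where φ^{-1}(H) ⊆ A'(W~) denotes the corresponding equivalence class. -/

import Mathlib

open MvPolynomial

noncomputable section

namespace ReflQuot

variable {k : Type} [Field k]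

/-- The action of an invertible matrix `g` on polynomial functions on `k^n`:
the linear form `X i` is sent to `∑ j, (g⁻¹) i j • X j`, so that
`(g • f) (v) = f (g⁻¹ ⬝ v)`. -/
def matAct {n : ℕ} (g : Matrix.GeneralLinearGroup (Fin n) k) :
    MvPolynomial (Fin n) k →ₐ[k] MvPolynomial (Fin n) k :=
  aeval fun i => ∑ j, ((↑(g⁻¹) : Matrix (Fin n) (Fin n) k) i j) • X j

/-- The algebra endomorphism of `k[X_1,…,X_m]` sending `X i` to `∑ j, M i j • X j`. -/
def polyAct {m : ℕ} (M : Fin m → Fin m → k) :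
    MvPolynomial (Fin m) k →ₐ[k] MvPolynomial (Fin m) k :=
  aeval fun i => ∑ j, M i j • X j

/-- A reflection: an automorphism of finite order whose fixed-point subspace is a
hyperplane. -/
def IsReflection {n : ℕ} (M : Matrix (Fin n) (Fin n) k) : Prop :=
  IsOfFinOrder M ∧
    Module.finrank k (LinearMap.ker (Matrix.toLin' M - LinearMap.id)) + 1 = n

/-- A double reflection: finite order, fixed points of codimension 2. -/
def IsDoubleReflection {n : ℕ} (M : Matrix (Fin n) (Fin n) k) : Prop :=
  IsOfFinOrder M ∧
    Module.finrank k (LinearMap.ker (Matrix.toLin' M - LinearMap.id)) + 2 = n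

/-- A reflection group: a group generated by its reflections. -/
def IsReflectionGroup {n : ℕ} (W : Subgroup (Matrix.GeneralLinearGroup (Fin n) k)) : Prop :=
  Subgroup.closure {g | g ∈ W ∧ IsReflection ((g : Matrix (Fin n) (Fin n) k))} = W

/-- The algebra of `G`-invariant polynomials. -/
def invariants {n : ℕ} (G : Subgroup (Matrix.GeneralLinearGroup (Fin n) k)) :
    Subalgebra k (MvPolynomial (Fin n) k) where
  carrier := {f | ∀ g ∈ G, matAct g f = f}
  mul_mem' := fun {a b} ha hb g hg => by
    rw [map_mul, ha g hg, hb g hg]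
  one_mem' := fun g _ => map_one (matAct g)
  add_mem' := fun {a b} ha hb g hg => by
    rw [map_add, ha g hg, hb g hg]
  zero_mem' := fun g _ => map_zero (matAct g)
  algebraMap_mem' := fun r g _ => (matAct g).commutes r

/-- The linear span of products of two positive-degree invariants, i.e. `(B^G_+)^2`. -/
def sqSpan {n : ℕ} (G : Subgroup (Matrix.GeneralLinearGroup (Fin n) k)) :
    Submodule k (MvPolynomial (Fin n) k) :=
  Submodule.span k {f | ∃ u ∈ invariants G, ∃ v ∈ invariants G,
    constantCoeff u = 0 ∧ constantCoeff v = 0 ∧ f = u * v}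

/-- The ideal of positive-degree elements of the polynomial ring. -/
def idealPlus (k : Type) [Field k] (m : ℕ) : Ideal (MvPolynomial (Fin m) k) :=
  Ideal.span (Set.range X)

/-- The ideal `I` of relations between the generators `p i` of the invariant algebra:
the kernel of `k[V] = k[X_1,…,X_m] → B^G`, `X i ↦ p i`. -/
def relIdeal {n m : ℕ} (p : Fin m → MvPolynomial (Fin n) k) :
    Ideal (MvPolynomial (Fin m) k) :=
  RingHom.ker (aeval p : MvPolynomial (Fin m) k →ₐ[k] MvPolynomial (Fin n) k)

/-- The context: `Wt` is a finite reflection group on `k^n`, `G` a normal subgroup of `Wt`,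
`p` a minimal system of homogeneous generators (of degrees `d`) of the invariant algebra
`B^G` whose span is `Wt`-stable (i.e. a graded `W`-equivariant section of
`B^G_+ → B^G_+/(B^G_+)^2`), and `c w` the matrix of the action of `w` on the span of the
`p i`, giving the induced action of `W = Wt/G` on `V = k^m`. -/
structure QuotSetup {n m : ℕ} (Wt G : Subgroup (Matrix.GeneralLinearGroup (Fin n) k))
    (p : Fin m → MvPolynomial (Fin n) k) (d : Fin m → ℕ)
    (c : ↥Wt → Fin m → Fin m → k) : Prop where
  finite : (Wt : Set (Matrix.GeneralLinearGroup (Fin n) k)).Finite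
  reflGroup : IsReflectionGroup Wt
  le : G ≤ Wt
  normal : ∀ w ∈ Wt, ∀ g ∈ G, w * g * w⁻¹ ∈ G
  homog : ∀ i, (p i).IsHomogeneous (d i)
  dpos : ∀ i, 0 < d i
  gen : Algebra.adjoin k (Set.range p) = invariants G
  minimal : ∀ a : Fin m → k, (∑ i, a i • p i) ∈ sqSpan G → a = 0
  equivar : ∀ (w : ↥Wt) (i), matAct (w : Matrix.GeneralLinearGroup (Fin n) k) (p i)
      = ∑ j, c w i j • p j

/-- `W = Wt/G` acts trivially on the conormal module `I/(A_+ I)`. -/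
def TrivialConormal {n m : ℕ} (Wt : Subgroup (Matrix.GeneralLinearGroup (Fin n) k))
    (p : Fin m → MvPolynomial (Fin n) k) (c : ↥Wt → Fin m → Fin m → k) : Prop :=
  ∀ w : ↥Wt, ∀ f ∈ relIdeal p, polyAct (c w) f - f ∈ idealPlus k m * relIdeal p

/-- `G` is of complete intersection: `I` is generated by `dim V - dim Vt = m - n` elements. -/
def IsCompleteIntersection {n m : ℕ} (p : Fin m → MvPolynomial (Fin n) k) : Prop :=
  ∃ s : Finset (MvPolynomial (Fin m) k), s.card = m - n ∧ Ideal.span (s : Set _) = relIdeal p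

/-- `G` is a good normal subgroup of `Wt`. -/
def IsGoodQuot {n m : ℕ} (Wt : Subgroup (Matrix.GeneralLinearGroup (Fin n) k))
    (p : Fin m → MvPolynomial (Fin n) k) (c : ↥Wt → Fin m → Fin m → k) : Prop :=
  IsCompleteIntersection p ∧ TrivialConormal Wt p c


/-- The pointwise stabilizer of a subspace `L` in `GL_n(k)`. -/
def pointStab {n : ℕ} (L : Submodule k (Fin n → k)) :
    Subgroup (Matrix.GeneralLinearGroup (Fin n) k) where
  carrier := {g | ∀ x ∈ L, Matrix.mulVec (g : Matrix (Fin n) (Fin n) k) x = x}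
  one_mem' := fun x _ => Matrix.one_mulVec x
  mul_mem' := fun {a b} ha hb x hx => by
    rw [Units.val_mul, ← Matrix.mulVec_mulVec, hb x hx, ha x hx]
  inv_mem' := fun {a} ha x hx => by
    have h1 : Matrix.mulVec (↑(a⁻¹) : Matrix (Fin n) (Fin n) k)
        (Matrix.mulVec (↑a : Matrix (Fin n) (Fin n) k) x) = x := by
      rw [Matrix.mulVec_mulVec, ← Units.val_mul, inv_mul_cancel, Units.val_one,
        Matrix.one_mulVec]
    rw [ha x hx] at h1
    exact h1

/-- The set of reflecting hyperplanes of a subgroup `W` of `GL_n(k)`. -/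
def reflHyps {n : ℕ} (W : Subgroup (Matrix.GeneralLinearGroup (Fin n) k)) :
    Set (Submodule k (Fin n → k)) :=
  {H | ∃ g ∈ W, IsReflection ((g : Matrix (Fin n) (Fin n) k)) ∧
      H = LinearMap.ker (Matrix.toLin' ((g : Matrix (Fin n) (Fin n) k)) - LinearMap.id)}

/-- The set `A'(Wt)` of reflecting hyperplanes `H` of `Wt` such that `Wt_H ≠ G_H`. -/
def reflHyps' {n : ℕ} (Wt G : Subgroup (Matrix.GeneralLinearGroup (Fin n) k)) :
    Set (Submodule k (Fin n → k)) :=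
  {H | H ∈ reflHyps Wt ∧ ¬ (Wt ⊓ pointStab H ≤ G)}

/-- `Wt_H` and `Wt_{H'}` have the same image in `W = Wt/G`. -/
def imageEq {n : ℕ} (Wt G : Subgroup (Matrix.GeneralLinearGroup (Fin n) k))
    (H H' : Submodule k (Fin n → k)) : Prop :=
  {x | ∃ g ∈ G, ∃ u ∈ Wt ⊓ pointStab H, x = g * u}
    = {x | ∃ g ∈ G, ∃ u ∈ Wt ⊓ pointStab H', x = g * u}

/-- `e_H = |G_H|`. -/
def eH {n : ℕ} (G : Subgroup (Matrix.GeneralLinearGroup (Fin n) k))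
    (H : Submodule k (Fin n → k)) : ℕ :=
  Nat.card ↥(G ⊓ pointStab H)

/-- The map `p : Vt → V`, `x ↦ (p 1 (x), …, p m (x))`. -/
def pMap {n m : ℕ} (p : Fin m → MvPolynomial (Fin n) k) (x : Fin n → k) : Fin m → k :=
  fun i => eval x (p i)

/-- The matrix of the action of (the image in `W` of) `w` on `V = k^m`. -/
def qMat {n m : ℕ} {Wt : Subgroup (Matrix.GeneralLinearGroup (Fin n) k)}
    (c : ↥Wt → Fin m → Fin m → k) (w : ↥Wt) : Matrix (Fin m) (Fin m) k :=
  Matrix.of (c w⁻¹)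

/-- The set of reflecting hyperplanes of `W = Wt/G` acting on `V = k^m`. -/
def reflHypsV {n m : ℕ} {Wt : Subgroup (Matrix.GeneralLinearGroup (Fin n) k)}
    (c : ↥Wt → Fin m → Fin m → k) : Set (Submodule k (Fin m → k)) :=
  {K | ∃ w : ↥Wt, IsReflection (qMat c w) ∧
      K = LinearMap.ker (Matrix.toLin' (qMat c w) - LinearMap.id)}

/-- The underlying matrix of an element of a subgroup of `GL_n(k)`. -/
def matOf {n : ℕ} {Wt : Subgroup (Matrix.GeneralLinearGroup (Fin n) k)} (w : ↥Wt) :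
    Matrix (Fin n) (Fin n) k :=
  ((w : Matrix.GeneralLinearGroup (Fin n) k) : Matrix (Fin n) (Fin n) k)

section Correspondence

open Matrix

/-! ### Linear forms -/

/-- The linear form on `k^n` with coefficient vector `a`. -/
def linForm {n : ℕ} (a : Fin n → k) : MvPolynomial (Fin n) k := ∑ i, C (a i) * X i

lemma eval_linForm {n : ℕ} (a x : Fin n → k) : eval x (linForm a) = a ⬝ᵥ x := by
  simp [linForm, dotProduct]

lemma isHomogeneous_linForm {n : ℕ} (a : Fin n → k) : (linForm a).IsHomogeneous 1 :=
  IsHomogeneous.sum _ _ _ fun i _ => isHomogeneous_C_mul_X (a i) i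

lemma linForm_add {n : ℕ} (a b : Fin n → k) : linForm (a + b) = linForm a + linForm b := by
  simp [linForm, add_mul, Finset.sum_add_distrib]

lemma linForm_smul {n : ℕ} (t : k) (a : Fin n → k) : linForm (t • a) = C t * linForm a := by
  simp [linForm, Finset.mul_sum, mul_assoc]

lemma linForm_sub {n : ℕ} (a b : Fin n → k) : linForm (a - b) = linForm a - linForm b := by
  simp [linForm, sub_mul, Finset.sum_sub_distrib]

lemma linForm_zero {n : ℕ} : linForm (0 : Fin n → k) = 0 := by
  simp [linForm]

lemma linForm_single {n : ℕ} (i : Fin n) : linForm (Pi.single i (1 : k)) = X i := by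
  classical
  simp [linForm, Pi.single_apply]

lemma exists_eq_linForm {n : ℕ} {f : MvPolynomial (Fin n) k} (hf : f.IsHomogeneous 1) :
    ∃ a, f = linForm a := by
  have h : f ∈ homogeneousSubmodule (Fin n) k 1 := hf
  rw [homogeneousSubmodule_one_eq_span_X, Submodule.mem_span_range_iff_exists_fun] at h
  obtain ⟨a, ha⟩ := h
  exact ⟨a, by simp [linForm, ← ha, smul_eq_C_mul]⟩

lemma exists_dotProduct_eq_one {n : ℕ} {a : Fin n → k} (ha : a ≠ 0) : ∃ z, a ⬝ᵥ z = 1 := by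
  obtain ⟨i, hi⟩ := Function.ne_iff.mp ha
  exact ⟨Pi.single i (a i)⁻¹, by simpa using mul_inv_cancel₀ hi⟩

lemma linForm_injective {n : ℕ} [Infinite k] {a b : Fin n → k} (h : linForm a = linForm b) :
    a = b := by
  have h' : ∀ x, a ⬝ᵥ x = b ⬝ᵥ x := fun x => by
    rw [← eval_linForm, ← eval_linForm, h]
  exact dotProduct_eq _ _ h'

lemma exists_eq_smul_of_forall {n : ℕ} {a b : Fin n → k} (ha : a ≠ 0)
    (h : ∀ x, a ⬝ᵥ x = 0 → b ⬝ᵥ x = 0) : ∃ t : k, b = t • a := by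
  obtain ⟨z, hz⟩ := exists_dotProduct_eq_one ha
  refine ⟨b ⬝ᵥ z, dotProduct_eq _ _ fun x => ?_⟩
  have h1 := h (x - (a ⬝ᵥ x) • z) (by rw [dotProduct_sub, dotProduct_smul, hz]; simp)
  rw [dotProduct_sub, dotProduct_smul, sub_eq_zero] at h1
  rw [h1, smul_dotProduct, smul_eq_mul, smul_eq_mul, mul_comm]

/-- Substitution by the projection onto the kernel of `linForm a` along `z`. -/
def restr {n : ℕ} (a z : Fin n → k) : MvPolynomial (Fin n) k →ₐ[k] MvPolynomial (Fin n) k :=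
  aeval fun i => X i - C (z i) * linForm a

lemma eval_restr {n : ℕ} (a z x : Fin n → k) (f : MvPolynomial (Fin n) k) :
    eval x (restr a z f) = eval (x - (a ⬝ᵥ x) • z) f := by
  have : (aeval x).comp (restr a z) = aeval (R := k) (x - (a ⬝ᵥ x) • z) := by
    apply MvPolynomial.algHom_ext
    intro i
    simp [restr, aeval_eq_eval, eval_linForm, mul_comm]
  simpa [aeval_eq_eval] using DFunLike.congr_fun this f

lemma linForm_dvd_sub_restr {n : ℕ} (a z : Fin n → k) (f : MvPolynomial (Fin n) k) :
    linForm a ∣ f - restr a z f := by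
  have : (Ideal.Quotient.mkₐ k (Ideal.span {linForm a})).comp (restr a z)
      = Ideal.Quotient.mkₐ k (Ideal.span {linForm a}) := by
    apply MvPolynomial.algHom_ext
    intro i
    simp only [restr, AlgHom.comp_apply, aeval_X, Ideal.Quotient.mkₐ_eq_mk]
    rw [Ideal.Quotient.eq, sub_sub_cancel_left]
    exact neg_mem (Ideal.mul_mem_left _ _ (Ideal.mem_span_singleton_self _))
  have h := DFunLike.congr_fun this f
  simp only [AlgHom.comp_apply, Ideal.Quotient.mkₐ_eq_mk] at h
  rwa [eq_comm, Ideal.Quotient.eq, Ideal.mem_span_singleton] at h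

lemma restr_eq_zero_iff {n : ℕ} [Infinite k] {a z : Fin n → k} (hz : a ⬝ᵥ z = 1)
    (f : MvPolynomial (Fin n) k) : restr a z f = 0 ↔ linForm a ∣ f := by
  constructor
  · intro h
    simpa [h] using linForm_dvd_sub_restr a z f
  · rintro ⟨g, rfl⟩
    rw [map_mul]
    have : restr a z (linForm a) = 0 := MvPolynomial.funext fun x => by
      rw [eval_restr, eval_linForm, dotProduct_sub, dotProduct_smul, hz]
      simp
    rw [this, zero_mul]

lemma linForm_dvd_iff {n : ℕ} [Infinite k] {a : Fin n → k} (ha : a ≠ 0)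
    (f : MvPolynomial (Fin n) k) : linForm a ∣ f ↔ ∀ x, a ⬝ᵥ x = 0 → eval x f = 0 := by
  obtain ⟨z, hz⟩ := exists_dotProduct_eq_one ha
  constructor
  · rintro ⟨g, rfl⟩ x hx
    rw [eval_mul, eval_linForm, hx, zero_mul]
  · intro h
    rw [← restr_eq_zero_iff hz]
    refine MvPolynomial.funext fun x => ?_
    rw [eval_restr, map_zero]
    exact h _ (by rw [dotProduct_sub, dotProduct_smul, hz]; simp)

lemma linForm_ne_zero {n : ℕ} [Infinite k] {a : Fin n → k} (ha : a ≠ 0) : linForm a ≠ 0 :=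
  fun h => ha (linForm_injective (h.trans linForm_zero.symm))

lemma prime_linForm {n : ℕ} [Infinite k] {a : Fin n → k} (ha : a ≠ 0) : Prime (linForm a) := by
  obtain ⟨z, hz⟩ := exists_dotProduct_eq_one ha
  refine ⟨linForm_ne_zero ha, fun h => ?_, fun f g h => ?_⟩
  · have h1 := (linForm_dvd_iff ha 1).mp h.dvd 0 (by simp)
    simp at h1
  · rw [← restr_eq_zero_iff hz, map_mul, mul_eq_zero] at h
    simpa [restr_eq_zero_iff hz] using h

lemma exists_of_linForm_dvd {n : ℕ} [Infinite k] {a b : Fin n → k} (ha : a ≠ 0)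
    (h : linForm a ∣ linForm b) : ∃ t : k, b = t • a := by
  refine exists_eq_smul_of_forall ha fun x hx => ?_
  rw [← eval_linForm]
  exact (linForm_dvd_iff ha _).mp h x hx

/-! ### Reflections as rank one perturbations of the identity -/

lemma one_add_vecMulVec_pow {n : ℕ} {r a : Fin n → k} (h : a ⬝ᵥ r = 0) (N : ℕ) :
    (1 + vecMulVec r a) ^ N = 1 + (N : k) • vecMulVec r a := by
  have h2 : vecMulVec r a * vecMulVec r a = 0 := by
    rw [vecMulVec_mul_vecMulVec, h, zero_smul]
    ext i j
    simp [vecMulVec]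
  induction N with
  | zero => simp
  | succ N ih =>
    rw [pow_succ, ih, mul_add, add_mul, add_mul, smul_mul_assoc (_ : k) _ (vecMulVec r a), h2]
    push_cast
    rw [add_smul]
    simp [add_assoc]

lemma dotProduct_ne_zero_of_isOfFinOrder {n : ℕ} [CharZero k] {r a : Fin n → k}
    (hr : r ≠ 0) (ha : a ≠ 0) (h : IsOfFinOrder (1 + vecMulVec r a)) : a ⬝ᵥ r ≠ 0 := by
  intro h0
  obtain ⟨N, hN, h1⟩ := h.exists_pow_eq_one
  rw [one_add_vecMulVec_pow h0, add_eq_left, smul_eq_zero] at h1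
  rcases h1 with h1 | h1
  · exact hN.ne' (by exact_mod_cast h1)
  · obtain ⟨i, hi⟩ := Function.ne_iff.mp hr
    obtain ⟨j, hj⟩ := Function.ne_iff.mp ha
    have := congrFun (congrFun h1 i) j
    rw [vecMulVec_apply] at this
    exact (mul_ne_zero hi hj) this

lemma vecMulVec_mulVec' {n : ℕ} (r a x : Fin n → k) :
    vecMulVec r a *ᵥ x = (a ⬝ᵥ x) • r := by
  ext i
  simp [vecMulVec_mulVec, mul_comm]

lemma mem_fixed_iff {n : ℕ} {r a : Fin n → k} (hr : r ≠ 0) (x : Fin n → k) :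
    x ∈ LinearMap.ker (Matrix.toLin' (1 + vecMulVec r a) - LinearMap.id) ↔ a ⬝ᵥ x = 0 := by
  simp [vecMulVec_mulVec', hr]

lemma isReflection_of_eq {n : ℕ} {r a : Fin n → k} (hr : r ≠ 0) (ha : a ≠ 0)
    (h : IsOfFinOrder (1 + vecMulVec r a)) : IsReflection (1 + vecMulVec r a) := by
  refine ⟨h, ?_⟩
  let φ : Module.Dual k (Fin n → k) := dotProductBilin k k a
  have hφ : φ ≠ 0 := by
    obtain ⟨z, hz⟩ := exists_dotProduct_eq_one ha
    intro h0
    have : φ z = 1 := hz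
    simp [h0] at this
  have h1 := Module.Dual.finrank_ker_add_one_of_ne_zero hφ
  rw [Module.finrank_fin_fun] at h1
  have h2 : LinearMap.ker (Matrix.toLin' (1 + vecMulVec r a) - LinearMap.id)
      = LinearMap.ker φ := by
    ext x
    rw [mem_fixed_iff hr, LinearMap.mem_ker]
    rfl
  rw [h2, h1]

lemma IsReflection.exists_eq {n : ℕ} {M : Matrix (Fin n) (Fin n) k} (h : IsReflection M) :
    ∃ r a, r ≠ 0 ∧ a ≠ 0 ∧ M = 1 + vecMulVec r a := by
  have h1 := LinearMap.finrank_range_add_finrank_ker (Matrix.toLin' M - LinearMap.id)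
  rw [Module.finrank_fin_fun] at h1
  have h2 : Module.finrank k (LinearMap.range (Matrix.toLin' M - LinearMap.id)) = 1 := by
    have := h.2
    omega
  obtain ⟨⟨r, hr⟩, hr0, h3⟩ := finrank_eq_one_iff'.mp h2
  have h4 : ∀ x, ∃ t : k, t • r = M *ᵥ x - x := fun x => by
    obtain ⟨t, ht⟩ := h3 ⟨_, LinearMap.mem_range_self _ x⟩
    exact ⟨t, by simpa using congrArg Subtype.val ht⟩
  choose a ha using fun i => h4 (Pi.single i 1)
  have hM : M = 1 + vecMulVec r a := by
    ext i j
    have := congrFun (ha j) i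
    simp only [mulVec_single_one, Pi.smul_apply, smul_eq_mul, Pi.sub_apply] at this
    rw [Matrix.add_apply, vecMulVec_apply, mul_comm, this, one_apply, Pi.single_apply]
    simp [col_apply]
  refine ⟨r, a, fun h0 => hr0 (Subtype.ext h0), ?_, hM⟩
  rintro rfl
  have : M = 1 := by
    rw [hM]
    ext i j
    simp
  obtain ⟨x, hx⟩ := hr
  refine hr0 (Subtype.ext (hx.symm.trans ?_))
  simp [this]

/-! ### The action on polynomials -/

lemma eval_matAct {n : ℕ} (g : GeneralLinearGroup (Fin n) k) (f : MvPolynomial (Fin n) k)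
    (x : Fin n → k) :
    eval x (matAct g f) = eval ((↑(g⁻¹) : Matrix (Fin n) (Fin n) k) *ᵥ x) f := by
  have : (aeval x).comp (matAct g)
      = aeval (R := k) ((↑(g⁻¹) : Matrix (Fin n) (Fin n) k) *ᵥ x) := by
    apply MvPolynomial.algHom_ext
    intro i
    simp [matAct, aeval_eq_eval, mulVec, dotProduct]
  simpa [aeval_eq_eval] using DFunLike.congr_fun this f

lemma matAct_one {n : ℕ} [Infinite k] (f : MvPolynomial (Fin n) k) : matAct 1 f = f :=
  MvPolynomial.funext fun x => by simp [eval_matAct]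

lemma matAct_mul {n : ℕ} [Infinite k] (g h : GeneralLinearGroup (Fin n) k)
    (f : MvPolynomial (Fin n) k) : matAct (g * h) f = matAct g (matAct h f) :=
  MvPolynomial.funext fun x => by
    rw [eval_matAct, eval_matAct, eval_matAct, mulVec_mulVec, _root_.mul_inv_rev, Units.val_mul]

lemma matAct_inv_matAct {n : ℕ} [Infinite k] (g : GeneralLinearGroup (Fin n) k)
    (f : MvPolynomial (Fin n) k) : matAct g⁻¹ (matAct g f) = f := by
  rw [← matAct_mul, inv_mul_cancel, matAct_one]

lemma matAct_matAct_inv {n : ℕ} [Infinite k] (g : GeneralLinearGroup (Fin n) k)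
    (f : MvPolynomial (Fin n) k) : matAct g (matAct g⁻¹ f) = f := by
  rw [← matAct_mul, mul_inv_cancel, matAct_one]

lemma matAct_linForm {n : ℕ} [Infinite k] (g : GeneralLinearGroup (Fin n) k) (a : Fin n → k) :
    matAct g (linForm a) = linForm (a ᵥ* (↑(g⁻¹) : Matrix (Fin n) (Fin n) k)) :=
  MvPolynomial.funext fun x => by
    rw [eval_matAct, eval_linForm, eval_linForm, dotProduct_mulVec]

lemma matAct_dvd_iff {n : ℕ} [Infinite k] (g : GeneralLinearGroup (Fin n) k)
    (f h : MvPolynomial (Fin n) k) : matAct g f ∣ h ↔ f ∣ matAct g⁻¹ h := by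
  constructor
  · intro H
    simpa [matAct_inv_matAct] using map_dvd (matAct g⁻¹) H
  · intro H
    simpa [matAct_matAct_inv] using map_dvd (matAct g) H

lemma matAct_ne_zero {n : ℕ} [Infinite k] (g : GeneralLinearGroup (Fin n) k)
    {f : MvPolynomial (Fin n) k} (hf : f ≠ 0) : matAct g f ≠ 0 := fun h =>
  hf (by rw [← matAct_inv_matAct g f, h, map_zero])

lemma prod_matAct_mem_invariants {n : ℕ} [Infinite k]
    (G : Subgroup (GeneralLinearGroup (Fin n) k)) [Fintype G] (f : MvPolynomial (Fin n) k) :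
    ∏ g : G, matAct (g : GeneralLinearGroup (Fin n) k) f ∈ invariants G := by
  intro h hh
  rw [map_prod]
  simp_rw [← matAct_mul]
  exact Fintype.prod_equiv (Equiv.mulLeft (⟨h, hh⟩ : G)) _ _ fun g => rfl

lemma sum_matAct_mem_invariants {n : ℕ} [Infinite k]
    (G : Subgroup (GeneralLinearGroup (Fin n) k)) [Fintype G] (f : MvPolynomial (Fin n) k) :
    ∑ g : G, matAct (g : GeneralLinearGroup (Fin n) k) f ∈ invariants G := by
  intro h hh
  rw [map_sum]
  simp_rw [← matAct_mul]
  exact Fintype.sum_equiv (Equiv.mulLeft (⟨h, hh⟩ : G)) _ _ fun g => rfl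

lemma mem_invariants_of_mul_mem {n : ℕ} {G : Subgroup (GeneralLinearGroup (Fin n) k)}
    {f g : MvPolynomial (Fin n) k} (hf : f ∈ invariants G) (hf0 : f ≠ 0)
    (h : g * f ∈ invariants G) : g ∈ invariants G := by
  intro u hu
  have h1 := h u hu
  rw [map_mul, hf u hu] at h1
  exact mul_right_cancel₀ hf0 h1

/-- If the order of `g₁` at the prime `π` is at most that of `g₂`, then `g₂ / g₁` can be written
as a fraction of invariants whose denominator is prime to `π`. -/
lemma exists_mul_eq_mul_of_pow_dvd {n : ℕ} [Infinite k]
    (G : Subgroup (GeneralLinearGroup (Fin n) k)) [Finite G] {π : MvPolynomial (Fin n) k}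
    (hπ : Prime π) {g₁ g₂ : MvPolynomial (Fin n) k} (h₁ : g₁ ∈ invariants G)
    (h₂ : g₂ ∈ invariants G) (h0 : g₁ ≠ 0) (hv : ∀ j : ℕ, π ^ j ∣ g₁ → π ^ j ∣ g₂) :
    ∃ b ∈ invariants G, ∃ c ∈ invariants G, ¬ π ∣ b ∧ b * g₂ = c * g₁ := by
  classical
  have := Fintype.ofFinite G
  obtain ⟨a₁, a₂, e, hrel, he₁, he₂⟩ :=
    UniqueFactorizationMonoid.exists_reduced_factors g₁ h0 g₂
  have he0 : e ≠ 0 := by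
    rintro rfl
    exact h0 (by rw [← he₁, zero_mul])
  have hπa : ¬ π ∣ a₁ := by
    intro hd
    obtain ⟨e', hee', hπe'⟩ := (FiniteMultiplicity.of_not_isUnit hπ.not_isUnit
      he0).exists_eq_pow_mul_and_not_dvd
    have h1 : π ^ (multiplicity π e + 1) ∣ g₁ := by
      rw [← he₁, pow_succ]
      exact mul_dvd_mul (pow_multiplicity_dvd π e) hd
    have h2 := hv _ h1
    rw [← he₂, hee', mul_assoc, ← hee', pow_succ] at h2
    have h3 := (mul_dvd_mul_iff_left (pow_ne_zero _ hπ.ne_zero)).mp h2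
    have h4 := (hπ.dvd_or_dvd h3).resolve_left hπe'
    exact hπ.not_isUnit (hrel hd h4)
  have hdvd : ∀ g ∈ G, a₁ ∣ matAct g a₁ := by
    intro g hg
    have h1 : g₁ * a₂ = g₂ * a₁ := by
      rw [← he₁, ← he₂]
      ring
    have h2 := congrArg (matAct g) h1
    rw [map_mul, map_mul, h₁ g hg, h₂ g hg, ← he₁, ← he₂, mul_assoc, mul_assoc] at h2
    have h3 := mul_left_cancel₀ he0 h2
    exact hrel.dvd_of_dvd_mul_left (Dvd.intro _ h3)
  refine ⟨_, prod_matAct_mem_invariants G a₁, ?_⟩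
  have h1 : a₁ ∣ ∏ g : G, matAct (g : GeneralLinearGroup (Fin n) k) a₁ := by
    rw [← Finset.mul_prod_erase _ _ (Finset.mem_univ (1 : G))]
    simp [matAct_one]
  obtain ⟨r, hr⟩ := h1
  have hkey : (∏ g : G, matAct (g : GeneralLinearGroup (Fin n) k) a₁) * g₂ = r * a₂ * g₁ := by
    rw [hr, ← he₁, ← he₂]
    ring
  refine ⟨r * a₂, ?_, ?_, hkey⟩
  · refine mem_invariants_of_mul_mem h₁ h0 ?_
    rw [← hkey]
    exact mul_mem (prod_matAct_mem_invariants G a₁) h₂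
  · intro hd
    obtain ⟨g, -, hg⟩ := (hπ.dvd_finsetProd_iff _).mp hd
    apply hπa
    refine hg.trans ?_
    rw [matAct_dvd_iff]
    exact hdvd _ (inv_mem g.2)

/-- If `w` acts trivially on the image of the `G`-invariants in a domain, then some element of
the coset `w G` acts trivially on the image of all polynomials. -/
lemma exists_mem_forall_map_matAct {n : ℕ} [Infinite k]
    (G : Subgroup (GeneralLinearGroup (Fin n) k)) [Finite G] {R : Type} [CommRing R] [IsDomain R]
    [Algebra k R] (ρ : MvPolynomial (Fin n) k →ₐ[k] R) (w : GeneralLinearGroup (Fin n) k)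
    (hw : ∀ f ∈ invariants G, ρ (matAct w f) = ρ f) :
    ∃ g ∈ G, ∀ f, ρ (matAct (w * g) f) = ρ f := by
  classical
  have := Fintype.ofFinite G
  have key : ∀ f, ∃ g : G, ρ (matAct (w * (g : GeneralLinearGroup (Fin n) k)) f) = ρ f := by
    intro f
    let Q : Polynomial (MvPolynomial (Fin n) k) :=
      ∏ g : G, (Polynomial.X - Polynomial.C (matAct (g : GeneralLinearGroup (Fin n) k) f))
    have hQ : ∀ i, Q.coeff i ∈ invariants G := by
      intro i h hh
      have : Q.map (matAct h).toRingHom = Q := by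
        simp only [Q, Polynomial.map_prod, Polynomial.map_sub, Polynomial.map_X,
          Polynomial.map_C, AlgHom.toRingHom_eq_coe, RingHom.coe_coe, ← matAct_mul]
        exact Fintype.prod_equiv (Equiv.mulLeft (⟨h, hh⟩ : G)) _ _ fun g => rfl
      conv_rhs => rw [← this]
      rw [Polynomial.coeff_map]
      rfl
    have h1 : Q.map (ρ.comp (matAct w)).toRingHom = Q.map ρ.toRingHom := by
      ext i
      rw [Polynomial.coeff_map, Polynomial.coeff_map]
      exact hw _ (hQ i)
    have h2 := congrArg (Polynomial.eval (ρ f)) h1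
    simp only [Q, Polynomial.map_prod, Polynomial.map_sub, Polynomial.map_X, Polynomial.map_C,
      Polynomial.eval_prod, Polynomial.eval_sub, Polynomial.eval_X, Polynomial.eval_C,
      AlgHom.toRingHom_eq_coe, RingHom.coe_coe, AlgHom.comp_apply, ← matAct_mul] at h2
    rw [Finset.prod_eq_zero (i := (1 : G)) (f := fun g : G =>
      ρ f - ρ (matAct (g : GeneralLinearGroup (Fin n) k) f)) (Finset.mem_univ _)
      (by simp [matAct_one]), Finset.prod_eq_zero_iff] at h2
    obtain ⟨g, -, hg⟩ := h2
    exact ⟨g, (sub_eq_zero.mp hg).symm⟩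
  let S : G → Submodule k (Fin n → k) := fun g =>
    { carrier := {a | ρ (matAct (w * (g : GeneralLinearGroup (Fin n) k)) (linForm a)) = ρ (linForm a)}
      add_mem' := fun {a b} ha hb => by
        simp only [Set.mem_ofPred_eq] at ha hb ⊢
        rw [linForm_add, map_add, map_add, map_add, ha, hb]
      zero_mem' := by simp [linForm_zero]
      smul_mem' := fun t a ha => by
        simp only [Set.mem_ofPred_eq] at ha ⊢
        rw [linForm_smul, map_mul, map_mul, map_mul, ha, ← algebraMap_eq, AlgHom.commutes] }
  have hS : ⋃ g, (S g : Set (Fin n → k)) = Set.univ := by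
    refine Set.eq_univ_of_forall fun a => Set.mem_iUnion.mpr ?_
    exact key (linForm a)
  obtain ⟨g, hg⟩ := Subspace.exists_eq_top_of_iUnion_eq_univ hS
  refine ⟨g, g.2, fun f => ?_⟩
  have : ρ.comp (matAct (w * (g : GeneralLinearGroup (Fin n) k))) = ρ := by
    apply MvPolynomial.algHom_ext
    intro i
    have : Pi.single i (1 : k) ∈ S g := by
      rw [hg]
      trivial
    simpa [S, linForm_single] using this
  exact DFunLike.congr_fun this f

/-- The kernel of the linear form with coefficient vector `a`. -/
def hyp {n : ℕ} (a : Fin n → k) : Submodule k (Fin n → k) :=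
  LinearMap.ker (dotProductBilin k k a)

lemma mem_hyp {n : ℕ} {a x : Fin n → k} : x ∈ hyp a ↔ a ⬝ᵥ x = 0 := Iff.rfl

lemma eq_one_of_forall_matAct {n : ℕ} [Infinite k] {g : GeneralLinearGroup (Fin n) k}
    (h : ∀ f, matAct g f = f) : g = 1 := by
  have h1 : (↑(g⁻¹) : Matrix (Fin n) (Fin n) k) = 1 := by
    ext i j
    have h2 := h (linForm (Pi.single i 1))
    rw [matAct_linForm] at h2
    have h3 := congrFun (linForm_injective h2) j
    rw [single_one_vecMul] at h3
    rw [one_apply, ← row_apply (↑(g⁻¹) : Matrix (Fin n) (Fin n) k), h3, Pi.single_apply]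
    simp [eq_comm]
  exact inv_eq_one.mp (Units.ext h1)

lemma eval_polyAct {m : ℕ} (M : Fin m → Fin m → k) (F : MvPolynomial (Fin m) k)
    (y : Fin m → k) : eval y (polyAct M F) = eval (of M *ᵥ y) F := by
  have : (aeval y).comp (polyAct M) = aeval (R := k) (of M *ᵥ y) := by
    apply MvPolynomial.algHom_ext
    intro i
    simp [polyAct, aeval_eq_eval, mulVec, dotProduct]
  simpa [aeval_eq_eval] using DFunLike.congr_fun this F

lemma polyAct_linForm {m : ℕ} [Infinite k] (M : Fin m → Fin m → k) (a : Fin m → k) :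
    polyAct M (linForm a) = linForm (a ᵥ* of M) :=
  MvPolynomial.funext fun x => by
    rw [eval_polyAct, eval_linForm, eval_linForm, dotProduct_mulVec]

lemma eval_aeval_pMap {n m : ℕ} (p : Fin m → MvPolynomial (Fin n) k)
    (F : MvPolynomial (Fin m) k) (x : Fin n → k) :
    eval x (aeval p F) = eval (pMap p x) F := by
  have : (aeval x).comp (aeval p) = aeval (R := k) (pMap p x) := by
    apply MvPolynomial.algHom_ext
    intro i
    simp [pMap, aeval_eq_eval]
  simpa [aeval_eq_eval] using DFunLike.congr_fun this F

namespace QuotSetup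

variable {n m : ℕ} {Wt G : Subgroup (GeneralLinearGroup (Fin n) k)}
  {p : Fin m → MvPolynomial (Fin n) k} {d : Fin m → ℕ} {c : ↥Wt → Fin m → Fin m → k}

lemma finite_group (hs : QuotSetup Wt G p d c) : Finite Wt := hs.finite

lemma finite_normal (hs : QuotSetup Wt G p d c) : Finite G :=
  (hs.finite.subset hs.le).to_subtype

lemma aeval_mem (hs : QuotSetup Wt G p d c) (F : MvPolynomial (Fin m) k) :
    aeval p F ∈ invariants G := by
  rw [← hs.gen, Algebra.adjoin_range_eq_range_aeval]
  exact ⟨F, rfl⟩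

lemma exists_aeval_eq (hs : QuotSetup Wt G p d c) {f : MvPolynomial (Fin n) k}
    (hf : f ∈ invariants G) : ∃ F : MvPolynomial (Fin m) k, aeval p F = f := by
  rwa [← hs.gen, Algebra.adjoin_range_eq_range_aeval] at hf

lemma eq_zero_of_aeval_linForm (hs : QuotSetup Wt G p d c) {a : Fin m → k}
    (h : aeval p (linForm a) = 0) : a = 0 := by
  refine hs.minimal a ?_
  have : ∑ i, a i • p i = aeval p (linForm a) := by
    simp [linForm, Algebra.smul_def]
  rw [this, h]
  exact zero_mem _

lemma aeval_linForm_injective (hs : QuotSetup Wt G p d c) {a b : Fin m → k}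
    (h : aeval p (linForm a) = aeval p (linForm b)) : a = b := by
  refine sub_eq_zero.mp (hs.eq_zero_of_aeval_linForm ?_)
  rw [linForm_sub, map_sub, h, sub_self]

lemma aeval_polyAct (hs : QuotSetup Wt G p d c) (w : Wt) (F : MvPolynomial (Fin m) k) :
    aeval p (polyAct (c w) F) = matAct w (aeval p F) := by
  have : (aeval p).comp (polyAct (c w))
      = (matAct (w : GeneralLinearGroup (Fin n) k)).comp (aeval (R := k) p) := by
    apply MvPolynomial.algHom_ext
    intro i
    simp [polyAct, hs.equivar w i]
  exact DFunLike.congr_fun this F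

lemma aeval_linForm_vecMul [Infinite k] (hs : QuotSetup Wt G p d c) (w : Wt)
    (a : Fin m → k) :
    aeval p (linForm (a ᵥ* of (c w))) = matAct w (aeval p (linForm a)) := by
  rw [← polyAct_linForm, hs.aeval_polyAct]

lemma mulVec_pMap (hs : QuotSetup Wt G p d c) (w : Wt) (x : Fin n → k) :
    of (c w) *ᵥ pMap p x =
      pMap p ((↑((w : GeneralLinearGroup (Fin n) k)⁻¹) : Matrix (Fin n) (Fin n) k) *ᵥ x) := by
  ext i
  have h1 := eval_polyAct (c w) (X i) (pMap p x)
  rw [← eval_aeval_pMap, hs.aeval_polyAct, eval_matAct] at h1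
  simpa [pMap] using h1.symm

lemma eq_of_forall_vecMul {M N : Matrix (Fin m) (Fin m) k} (h : ∀ a, a ᵥ* M = a ᵥ* N) :
    M = N := by
  ext i j
  have := congrFun (h (Pi.single i 1)) j
  simpa [single_one_vecMul] using this

lemma c_mul [Infinite k] (hs : QuotSetup Wt G p d c) (w w' : Wt) :
    of (c (w * w')) = of (c w') * of (c w) := by
  refine eq_of_forall_vecMul fun a => hs.aeval_linForm_injective ?_
  rw [← vecMul_vecMul, hs.aeval_linForm_vecMul, hs.aeval_linForm_vecMul,
    hs.aeval_linForm_vecMul, Subgroup.coe_mul, matAct_mul]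

lemma c_eq_one [Infinite k] (hs : QuotSetup Wt G p d c) {w : Wt} (hw : (w : GL (Fin n) k) ∈ G) :
    of (c w) = 1 := by
  refine eq_of_forall_vecMul fun a => hs.aeval_linForm_injective ?_
  rw [hs.aeval_linForm_vecMul, hs.aeval_mem _ _ hw, vecMul_one]

lemma c_one [Infinite k] (hs : QuotSetup Wt G p d c) : of (c 1) = 1 :=
  hs.c_eq_one (one_mem G)

lemma c_pow [Infinite k] (hs : QuotSetup Wt G p d c) (w : Wt) (N : ℕ) :
    of (c (w ^ N)) = of (c w) ^ N := by
  induction N with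
  | zero => rw [pow_zero, pow_zero, hs.c_one]
  | succ N ih => rw [pow_succ, pow_succ', hs.c_mul, ih]

lemma mem_of_c_eq_one [Infinite k] (hs : QuotSetup Wt G p d c) {w : Wt} (hw : of (c w) = 1) :
    (w : GL (Fin n) k) ∈ G := by
  have := hs.finite_normal
  obtain ⟨g, hg, h⟩ := exists_mem_forall_map_matAct G (AlgHom.id k _) (w : GL (Fin n) k) (by
    intro f hf
    obtain ⟨F, rfl⟩ := hs.exists_aeval_eq hf
    refine MvPolynomial.funext fun x => ?_
    rw [AlgHom.id_apply, AlgHom.id_apply, eval_matAct, eval_aeval_pMap, ← hs.mulVec_pMap, hw,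
      one_mulVec, eval_aeval_pMap])
  have h1 := eq_one_of_forall_matAct h
  rw [eq_inv_of_mul_eq_one_left h1]
  exact inv_mem hg

lemma isOfFinOrder_c [Infinite k] (hs : QuotSetup Wt G p d c) (w : Wt) :
    IsOfFinOrder (of (c w)) := by
  have := hs.finite_group
  obtain ⟨N, hN, h⟩ := (isOfFinOrder_of_finite w).exists_pow_eq_one
  refine isOfFinOrder_iff_pow_eq_one.mpr ⟨N, hN, ?_⟩
  rw [← hs.c_pow, h, hs.c_one]

lemma polyAct_mul [Infinite k] (hs : QuotSetup Wt G p d c) (w w' : Wt)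
    (F : MvPolynomial (Fin m) k) :
    polyAct (c (w * w')) F = polyAct (c w) (polyAct (c w') F) :=
  MvPolynomial.funext fun y => by
    rw [eval_polyAct, eval_polyAct, eval_polyAct, hs.c_mul, mulVec_mulVec]

lemma polyAct_mem_relIdeal (hs : QuotSetup Wt G p d c) (w : Wt)
    {F : MvPolynomial (Fin m) k} (hF : F ∈ relIdeal p) : polyAct (c w) F ∈ relIdeal p := by
  have hF' : aeval p F = 0 := hF
  change aeval p (polyAct (c w) F) = 0
  rw [hs.aeval_polyAct, hF', map_zero]

/-- If `W` acts trivially on the conormal module then, locally at the origin, the ideal of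
relations is generated by `W`-invariant relations. -/
lemma exists_mul_mem_span [CharZero k] (hs : QuotSetup Wt G p d c)
    (ht : TrivialConormal Wt p c) :
    ∃ a : MvPolynomial (Fin m) k, constantCoeff a = 1 ∧ ∀ f ∈ relIdeal p,
      a * f ∈ Ideal.span {f | f ∈ relIdeal p ∧ ∀ w, polyAct (c w) f = f} := by
  have := hs.finite_group
  have := Fintype.ofFinite Wt
  have hfg : (relIdeal p).FG := IsNoetherian.noetherian _
  have hle : relIdeal p ≤ Ideal.span {f | f ∈ relIdeal p ∧ ∀ w, polyAct (c w) f = f}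
      ⊔ idealPlus k m • relIdeal p := by
    intro f hf
    have hN : (Fintype.card Wt : k) ≠ 0 := by
      exact_mod_cast Fintype.card_ne_zero
    have h1 : f = C (Fintype.card Wt : k)⁻¹ * ∑ w, polyAct (c w) f
        - C (Fintype.card Wt : k)⁻¹ * ∑ w, (polyAct (c w) f - f) := by
      rw [Finset.sum_sub_distrib, mul_sub, sub_sub_cancel, Finset.sum_const, Finset.card_univ,
        nsmul_eq_mul, ← mul_assoc, ← map_natCast (C (σ := Fin m)), ← C_mul, inv_mul_cancel₀ hN,
        C_1, one_mul]
    rw [h1]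
    refine sub_mem (Submodule.mem_sup_left ?_) (Submodule.mem_sup_right ?_)
    · refine Ideal.subset_span ⟨Ideal.mul_mem_left _ _
        (sum_mem fun w _ => hs.polyAct_mem_relIdeal w hf), fun w => ?_⟩
      rw [map_mul, map_sum, ← algebraMap_eq, AlgHom.commutes]
      simp_rw [← hs.polyAct_mul]
      congr 1
      exact Fintype.sum_equiv (Equiv.mulLeft w) _ _ fun g => rfl
    · exact Ideal.mul_mem_left _ _ (sum_mem fun w _ => ht w f hf)
  obtain ⟨r, hr1, hr⟩ :=
    Submodule.exists_sub_one_mem_and_smul_le_of_fg_of_le_sup hfg le_rfl hle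
  refine ⟨r, ?_, fun f hf => ?_⟩
  · have h2 : idealPlus k m ≤ RingHom.ker (constantCoeff (R := k) (σ := Fin m)) := by
      rw [idealPlus, Ideal.span_le]
      rintro _ ⟨i, rfl⟩
      simp
    have h3 : constantCoeff (r - 1) = 0 := h2 hr1
    simpa [sub_eq_zero] using h3
  · exact hr (Submodule.smul_mem_pointwise_smul f r _ hf)

end QuotSetup

/-! ### First-order expansions -/

/-- The first-order Taylor expansion `F ↦ F (y + ε v)`, with values in the dual numbers. -/
def jet {m : ℕ} (y v : Fin m → k) : MvPolynomial (Fin m) k →ₐ[k] DualNumber k :=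
  aeval fun i => TrivSqZeroExt.inl (y i) + TrivSqZeroExt.inr (v i)

lemma fst_jet {m : ℕ} (y v : Fin m → k) (F : MvPolynomial (Fin m) k) :
    (jet y v F).fst = eval y F := by
  have : (TrivSqZeroExt.fstHom k k k).comp (jet y v) = aeval (R := k) y := by
    apply MvPolynomial.algHom_ext
    intro i
    simp [jet]
  simpa [aeval_eq_eval] using DFunLike.congr_fun this F

lemma jet_polyAct {m : ℕ} (M : Fin m → Fin m → k) (y v : Fin m → k)
    (F : MvPolynomial (Fin m) k) : jet y v (polyAct M F) = jet (of M *ᵥ y) (of M *ᵥ v) F := by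
  have : (jet y v).comp (polyAct M) = jet (of M *ᵥ y) (of M *ᵥ v) := by
    apply MvPolynomial.algHom_ext
    intro i
    ext
    · simp [jet, polyAct, mulVec, dotProduct, TrivSqZeroExt.fst_sum]
    · simp [jet, polyAct, mulVec, dotProduct, TrivSqZeroExt.snd_sum]
  exact DFunLike.congr_fun this F

lemma snd_jet_linForm {m : ℕ} (y v a : Fin m → k) : (jet y v (linForm a)).snd = a ⬝ᵥ v := by
  rw [linForm, map_sum, TrivSqZeroExt.snd_sum, dotProduct]
  refine Finset.sum_congr rfl fun i _ => ?_
  rw [map_mul, ← algebraMap_eq, AlgHom.commutes, ← Algebra.smul_def]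
  simp [jet]

lemma snd_jet_mul_of_eval_eq_zero {m : ℕ} (y v : Fin m → k) (F H : MvPolynomial (Fin m) k)
    (hH : eval y H = 0) : (jet y v (F * H)).snd = eval y F * (jet y v H).snd := by
  rw [map_mul, TrivSqZeroExt.snd_mul, fst_jet, fst_jet, hH]
  simp

namespace QuotSetup

variable {n m : ℕ} {Wt G : Subgroup (GeneralLinearGroup (Fin n) k)}
  {p : Fin m → MvPolynomial (Fin n) k} {d : Fin m → ℕ} {c : ↥Wt → Fin m → Fin m → k}

lemma mulVec_pMap_of_mem_pointStab (hs : QuotSetup Wt G p d c) {L : Submodule k (Fin n → k)}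
    {u : Wt} (hu : (u : GL (Fin n) k) ∈ pointStab L) {x : Fin n → k} (hx : x ∈ L) :
    of (c u) *ᵥ pMap p x = pMap p x := by
  rw [hs.mulVec_pMap, (inv_mem hu : (u : GL (Fin n) k)⁻¹ ∈ pointStab L) x hx]

/-- Elements of the ideal generated by invariant relations are invariant to first order. -/
lemma snd_jet_eq_of_mem_span (hs : QuotSetup Wt G p d c) {L : Submodule k (Fin n → k)}
    {u : Wt} (hu : (u : GL (Fin n) k) ∈ pointStab L) {x : Fin n → k} (hx : x ∈ L)
    {F : MvPolynomial (Fin m) k}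
    (hF : F ∈ Ideal.span {f | f ∈ relIdeal p ∧ ∀ w, polyAct (c w) f = f}) (v : Fin m → k) :
    eval (pMap p x) F = 0 ∧
      (jet (pMap p x) (of (c u) *ᵥ v) F).snd = (jet (pMap p x) v F).snd := by
  induction hF using Submodule.span_induction with
  | mem f hf =>
    refine ⟨?_, ?_⟩
    · rw [← eval_aeval_pMap, show aeval p f = 0 from hf.1, map_zero]
    · conv_rhs => rw [← hf.2 u, jet_polyAct, hs.mulVec_pMap_of_mem_pointStab hu hx]
  | zero => simp
  | add f g _ _ hf hg => simp [hf.1, hg.1, hf.2, hg.2]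
  | smul a f _ hf =>
    refine ⟨by simp [hf.1], ?_⟩
    rw [smul_eq_mul, snd_jet_mul_of_eval_eq_zero _ _ _ _ hf.1,
      snd_jet_mul_of_eval_eq_zero _ _ _ _ hf.1, hf.2]

/-- Comparison of the first-order behaviour, under the pointwise stabilizer of a hyperplane, of
two functions on `V` whose restrictions to `V~/G` vanish along the image of this hyperplane. -/
lemma exists_jet_relation [CharZero k] (hs : QuotSetup Wt G p d c)
    (ht : TrivialConormal Wt p c) {a : Fin n → k} (ha : a ≠ 0) {F₁ F₂ : MvPolynomial (Fin m) k}
    (h₁ : linForm a ∣ aeval p F₁) (h₂ : linForm a ∣ aeval p F₂) (h0 : aeval p F₁ ≠ 0)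
    (hv : ∀ j : ℕ, linForm a ^ j ∣ aeval p F₁ → linForm a ^ j ∣ aeval p F₂) :
    ∃ x ∈ hyp a, ∃ β γ : k, β ≠ 0 ∧
      (∀ j : ℕ, linForm a ^ j ∣ aeval p F₂ → ¬ linForm a ^ j ∣ aeval p F₁ → γ = 0) ∧
      ∀ u : Wt, (u : GL (Fin n) k) ∈ pointStab (hyp a) → ∀ v : Fin m → k,
        β * ((jet (pMap p x) (of (c u) *ᵥ v) F₂).snd - (jet (pMap p x) v F₂).snd)
          = γ * ((jet (pMap p x) (of (c u) *ᵥ v) F₁).snd - (jet (pMap p x) v F₁).snd) := by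
  have := hs.finite_normal
  have hπ := prime_linForm ha
  obtain ⟨b, hb, e, he, hbπ, hbe⟩ := exists_mul_eq_mul_of_pow_dvd G hπ (hs.aeval_mem F₁)
    (hs.aeval_mem F₂) h0 hv
  obtain ⟨Q, hQ1, hQ⟩ := hs.exists_mul_mem_span ht
  obtain ⟨B, rfl⟩ := hs.exists_aeval_eq hb
  obtain ⟨E, rfl⟩ := hs.exists_aeval_eq he
  have hp0 : pMap p 0 = 0 := by
    ext i
    have h := (hs.homog i).coeff_eq_zero (d := 0) (by simpa using (hs.dpos i).ne)
    simpa [pMap, constantCoeff_eq] using h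
  have hQπ : ¬ linForm a ∣ aeval p Q := by
    intro h
    have h1 := (linForm_dvd_iff ha _).mp h 0 (by simp)
    rw [eval_aeval_pMap, hp0, eval_zero, hQ1] at h1
    exact one_ne_zero h1
  have hQB : ¬ linForm a ∣ aeval p (Q * B) := by
    rw [map_mul]
    exact fun h => (hπ.dvd_or_dvd h).elim hQπ hbπ
  rw [linForm_dvd_iff ha] at hQB
  push Not at hQB
  obtain ⟨x, hx, hxQB⟩ := hQB
  have hF₁ : eval (pMap p x) F₁ = 0 := by
    rw [← eval_aeval_pMap]
    exact (linForm_dvd_iff ha _).mp h₁ x hx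
  have hF₂ : eval (pMap p x) F₂ = 0 := by
    rw [← eval_aeval_pMap]
    exact (linForm_dvd_iff ha _).mp h₂ x hx
  rw [eval_aeval_pMap] at hxQB
  refine ⟨x, hx, _, eval (pMap p x) (Q * E), hxQB, ?_, ?_⟩
  · intro j hj₂ hj₁
    have h1 : linForm a ∣ aeval p E := by
      by_contra h
      refine hj₁ (hπ.pow_dvd_of_dvd_mul_left j h ?_)
      rw [← hbe]
      exact hj₂.mul_left _
    rw [map_mul, ← eval_aeval_pMap p E, (linForm_dvd_iff ha _).mp h1 x hx, mul_zero]
  · intro u hu v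
    have hmem : Q * B * F₂ - Q * E * F₁
        ∈ Ideal.span {f | f ∈ relIdeal p ∧ ∀ w, polyAct (c w) f = f} := by
      rw [mul_assoc, mul_assoc, ← mul_sub]
      refine hQ _ ?_
      change aeval p _ = 0
      rw [map_sub, map_mul, map_mul, hbe, sub_self]
    have h := (hs.snd_jet_eq_of_mem_span hu hx hmem v).2
    simp only [map_sub, TrivSqZeroExt.snd_sub, snd_jet_mul_of_eval_eq_zero _ _ _ _ hF₁,
      snd_jet_mul_of_eval_eq_zero _ _ _ _ hF₂] at h
    linear_combination h

end QuotSetup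

/-! ### The action of the pointwise stabilizer of a hyperplane -/

lemma forall_pow_dvd_or {R : Type*} [CommMonoid R] (q f g : R) :
    (∀ j : ℕ, q ^ j ∣ f → q ^ j ∣ g) ∨ ∀ j : ℕ, q ^ j ∣ g → q ^ j ∣ f := by
  simp_rw [pow_dvd_iff_le_emultiplicity]
  exact (le_total (emultiplicity q f) (emultiplicity q g)).imp (fun h _ hj => hj.trans h)
    fun h _ hj => hj.trans h

namespace QuotSetup

variable {n m : ℕ} {Wt G : Subgroup (GeneralLinearGroup (Fin n) k)}
  {p : Fin m → MvPolynomial (Fin n) k} {d : Fin m → ℕ} {c : ↥Wt → Fin m → Fin m → k}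

lemma eval_aeval_linForm (p : Fin m → MvPolynomial (Fin n) k) (b : Fin m → k) (x : Fin n → k) :
    eval x (aeval p (linForm b)) = b ⬝ᵥ pMap p x := by
  rw [eval_aeval_pMap, eval_linForm]

/-- The pointwise stabilizer of a hyperplane moves linear forms on `V` along a single line. -/
lemma exists_forall_vecMul_sub [CharZero k] (hs : QuotSetup Wt G p d c)
    (ht : TrivialConormal Wt p c) {a : Fin n → k} (ha : a ≠ 0) :
    ∃ ℓ : Fin m → k, ∀ u : Wt, (u : GL (Fin n) k) ∈ pointStab (hyp a) → ∀ b : Fin m → k,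
      ∃ t : k, b ᵥ* of (c u) - b = t • ℓ := by
  classical
  have := hs.finite_group
  let Γ : Subgroup Wt := (pointStab (hyp a)).comap Wt.subtype
  have := Fintype.ofFinite Γ
  have hcard : (Fintype.card Γ : k) ≠ 0 := Nat.cast_ne_zero.mpr Fintype.card_ne_zero
  let E : (Fin m → k) → (Fin m → k) := fun b => ∑ u : Γ, b ᵥ* of (c (u : Wt))
  let N : (Fin m → k) → (Fin m → k) := fun b => (Fintype.card Γ : k) • b - E b
  have hE₁ (u : Γ) (b) : E b ᵥ* of (c (u : Wt)) = E b := by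
    simp only [E, sum_vecMul, vecMul_vecMul, ← hs.c_mul]
    exact Fintype.sum_equiv (Equiv.mulLeft u) _ _ fun _ => rfl
  have hE₂ (u : Γ) (b) : E (b ᵥ* of (c (u : Wt))) = E b := by
    simp only [E, vecMul_vecMul, ← hs.c_mul]
    exact Fintype.sum_equiv (Equiv.mulRight u) _ _ fun _ => rfl
  have hN (b) : ∑ u : Γ, N b ᵥ* of (c (u : Wt)) = 0 := by
    simp only [N, sub_vecMul, smul_vecMul, hE₁, Finset.sum_sub_distrib, ← Finset.smul_sum]
    simp [E, Nat.cast_smul_eq_nsmul]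
  have hdvd (b) : linForm a ∣ aeval p (linForm (N b)) := by
    refine (linForm_dvd_iff ha _).mpr fun x hx => ?_
    rw [eval_aeval_linForm, sub_dotProduct, smul_dotProduct, sum_dotProduct]
    have (u : Γ) : (b ᵥ* of (c (u : Wt))) ⬝ᵥ pMap p x = b ⬝ᵥ pMap p x := by
      rw [← dotProduct_mulVec, hs.mulVec_pMap_of_mem_pointStab u.2 (mem_hyp.mpr hx)]
    simp [this]
  have key (b₁ b₂) (h0 : N b₁ ≠ 0)
      (hv : ∀ j : ℕ, linForm a ^ j ∣ aeval p (linForm (N b₁)) →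
        linForm a ^ j ∣ aeval p (linForm (N b₂))) : ∃ t : k, N b₂ = t • N b₁ := by
    obtain ⟨x, -, β, γ, hβ, -, h⟩ := hs.exists_jet_relation ht ha (hdvd b₁) (hdvd b₂)
      (fun h => h0 (hs.eq_zero_of_aeval_linForm h)) hv
    simp only [snd_jet_linForm] at h
    refine ⟨β⁻¹ * γ, dotProduct_eq _ _ fun v => ?_⟩
    have h1 := Finset.sum_congr (rfl : (Finset.univ : Finset Γ) = _)
      fun (u : Γ) _ => h u u.2 v
    have h2 (b) : ∑ u : Γ, N b ⬝ᵥ (of (c (u : Wt)) *ᵥ v) = 0 := by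
      simp_rw [dotProduct_mulVec, ← sum_dotProduct, hN, zero_dotProduct]
    rw [← Finset.mul_sum, ← Finset.mul_sum, Finset.sum_sub_distrib, Finset.sum_sub_distrib,
      h2, h2, Finset.sum_const, Finset.sum_const, Finset.card_univ, nsmul_eq_mul,
      nsmul_eq_mul] at h1
    rw [smul_dotProduct, smul_eq_mul]
    field_simp
    refine mul_left_cancel₀ hcard ?_
    linear_combination -h1
  have hℓ : ∃ ℓ, ∀ b, ∃ t : k, N b = t • ℓ := by
    by_cases h : ∀ b, N b = 0
    · exact ⟨0, fun b => ⟨0, by simp [h b]⟩⟩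
    · push Not at h
      obtain ⟨b₀, hb₀⟩ := h
      refine ⟨N b₀, fun b => ?_⟩
      by_cases hb : N b = 0
      · exact ⟨0, by simp [hb]⟩
      rcases forall_pow_dvd_or (linForm a) (aeval p (linForm (N b₀)))
        (aeval p (linForm (N b))) with hv | hv
      · exact key b₀ b hb₀ hv
      · obtain ⟨t, h⟩ := key b b₀ hb hv
        have : t ≠ 0 := by
          rintro rfl
          exact hb₀ (by simpa using h)
        exact ⟨t⁻¹, by rw [h, smul_smul, inv_mul_cancel₀ this, one_smul]⟩
  obtain ⟨ℓ, hℓ⟩ := hℓ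
  refine ⟨ℓ, fun u hu b => ?_⟩
  obtain ⟨t, ht⟩ := hℓ (b ᵥ* of (c u) - b)
  have h1 : E (b ᵥ* of (c u) - b) = 0 := by
    rw [← sub_eq_zero.mpr (hE₂ ⟨u, hu⟩ b)]
    simp [E, sub_vecMul]
  refine ⟨(Fintype.card Γ : k)⁻¹ * t, ?_⟩
  rw [mul_smul, ← ht, show N (b ᵥ* of (c u) - b) = (Fintype.card Γ : k) • (b ᵥ* of (c u) - b)
    - E (b ᵥ* of (c u) - b) from rfl, h1, sub_zero, smul_smul, inv_mul_cancel₀ hcard,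
    one_smul]

end QuotSetup

/-! ### Reflecting hyperplanes -/

lemma exists_eq_one_add_vecMulVec {m : ℕ} {M : Matrix (Fin m) (Fin m) k} {ℓ : Fin m → k}
    (h : ∀ b : Fin m → k, ∃ t : k, b ᵥ* M - b = t • ℓ) : ∃ r, M = 1 + vecMulVec r ℓ := by
  choose t ht using h
  refine ⟨fun i => t (Pi.single i 1), ?_⟩
  ext i j
  have := congrFun (ht (Pi.single i 1)) j
  rw [single_one_vecMul] at this
  simp only [Pi.sub_apply, row_apply, Pi.smul_apply, smul_eq_mul] at this
  rw [Matrix.add_apply, vecMulVec_apply, ← this, one_apply, Pi.single_apply]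
  simp [eq_comm]

lemma hyp_eq_iff {n : ℕ} {a b : Fin n → k} (ha : a ≠ 0) (hb : b ≠ 0) :
    hyp a = hyp b ↔ ∃ t : k, t ≠ 0 ∧ b = t • a := by
  constructor
  · intro h
    obtain ⟨t, rfl⟩ := exists_eq_smul_of_forall (b := b) ha
      fun x hx => mem_hyp.mp (h ▸ mem_hyp.mpr hx)
    exact ⟨t, fun h => hb (by rw [h, zero_smul]), rfl⟩
  · rintro ⟨t, ht, rfl⟩
    ext x
    simp [mem_hyp, ht]

lemma exists_of_mem_reflHyps {n : ℕ} {W : Subgroup (GL (Fin n) k)}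
    {H : Submodule k (Fin n → k)} {f : MvPolynomial (Fin n) k} (hH : H ∈ reflHyps W)
    (hf : f.IsHomogeneous 1) (h : ∀ x, eval x f = 0 ↔ x ∈ H) :
    ∃ a, a ≠ 0 ∧ f = linForm a ∧ H = hyp a := by
  obtain ⟨a, rfl⟩ := exists_eq_linForm hf
  have hHa : H = hyp a := by
    ext x
    rw [← h, eval_linForm, mem_hyp]
  refine ⟨a, ?_, rfl, hHa⟩
  rintro rfl
  obtain ⟨g, -, ⟨-, hg⟩, rfl⟩ := hH
  have h1 : LinearMap.ker (toLin' (g : Matrix (Fin n) (Fin n) k) - LinearMap.id) = ⊤ :=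
    hHa.trans (by ext x; simp [mem_hyp])
  rw [h1, finrank_top] at hg
  simp at hg

lemma ker_toLin'_sub_id {n : ℕ} {r : Fin n → k} (hr : r ≠ 0) (a : Fin n → k) :
    LinearMap.ker (toLin' (1 + vecMulVec r a) - LinearMap.id) = hyp a := by
  ext x
  rw [mem_fixed_iff hr, mem_hyp]

namespace QuotSetup

variable {n m : ℕ} {Wt G : Subgroup (GeneralLinearGroup (Fin n) k)}
  {p : Fin m → MvPolynomial (Fin n) k} {d : Fin m → ℕ} {c : ↥Wt → Fin m → Fin m → k}

lemma exists_of_mem_reflHypsV [CharZero k] {K : Submodule k (Fin m → k)}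
    (hK : K ∈ reflHypsV c) :
    ∃ (w : Wt) (r a : Fin m → k), a ⬝ᵥ r ≠ 0 ∧ of (c w) = 1 + vecMulVec r a ∧ K = hyp a := by
  obtain ⟨w, hw, rfl⟩ := hK
  obtain ⟨r, a, hr, ha, h⟩ := hw.exists_eq
  refine ⟨w⁻¹, r, a, ?_, h, by rw [h, ker_toLin'_sub_id hr]⟩
  exact dotProduct_ne_zero_of_isOfFinOrder hr ha (h ▸ hw.1)

lemma hyp_mem_reflHypsV [CharZero k] (hs : QuotSetup Wt G p d c) {w : Wt} {r a : Fin m → k}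
    (hr : r ≠ 0) (ha : a ≠ 0) (h : of (c w) = 1 + vecMulVec r a) : hyp a ∈ reflHypsV c := by
  have hq : qMat c w⁻¹ = 1 + vecMulVec r a := by rw [qMat, inv_inv, h]
  refine ⟨w⁻¹, ?_, by rw [hq, ker_toLin'_sub_id hr]⟩
  rw [hq]
  exact isReflection_of_eq hr ha (h ▸ hs.isOfFinOrder_c w)

lemma exists_vecMulVec_of_mem_pointStab [CharZero k] (hs : QuotSetup Wt G p d c)
    (ht : TrivialConormal Wt p c) {a : Fin n → k} (ha : a ≠ 0) :
    ∃ ℓ : Fin m → k, ∀ u : Wt, (u : GL (Fin n) k) ∈ pointStab (hyp a) →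
      ∃ r, of (c u) = 1 + vecMulVec r ℓ := by
  obtain ⟨ℓ, h⟩ := hs.exists_forall_vecMul_sub ht ha
  exact ⟨ℓ, fun u hu => exists_eq_one_add_vecMulVec (h u hu)⟩

/-- An element acting as a reflection on `V` acts, modulo any prime factor of the form defining
the reflecting hyperplane, as an element of `G`. -/
lemma exists_mem_forall_dvd [CharZero k] (hs : QuotSetup Wt G p d c) {w : Wt}
    {r a : Fin m → k} (hw : of (c w) = 1 + vecMulVec r a) {π : MvPolynomial (Fin n) k}
    (hπ : Prime π) (h : π ∣ aeval p (linForm a)) :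
    ∃ g : Wt, (g : GL (Fin n) k) ∈ G ∧
      ∀ f, π ∣ matAct ((w * g : Wt) : GL (Fin n) k) f - f := by
  have := hs.finite_normal
  have hP : (Ideal.span {π}).IsPrime := (Ideal.span_singleton_prime hπ.ne_zero).mpr hπ
  obtain ⟨g, hg, H⟩ := exists_mem_forall_map_matAct G
    (Ideal.Quotient.mkₐ k (Ideal.span {π})) (w : GL (Fin n) k) (by
    intro f hf
    obtain ⟨F, rfl⟩ := hs.exists_aeval_eq hf
    have : (Ideal.Quotient.mkₐ k (Ideal.span {π})).comp
        ((matAct (w : GL (Fin n) k)).comp (aeval (R := k) p))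
        = (Ideal.Quotient.mkₐ k (Ideal.span {π})).comp (aeval p) := by
      apply MvPolynomial.algHom_ext
      intro i
      have h1 := hs.aeval_linForm_vecMul w (Pi.single i 1)
      rw [hw, vecMul_add, vecMul_one, linForm_add, map_add, vecMul_vecMulVec,
        linForm_smul, map_mul, linForm_single, aeval_X] at h1
      simp only [AlgHom.comp_apply, aeval_X, Ideal.Quotient.mkₐ_eq_mk]
      rw [Ideal.Quotient.eq, ← h1, add_sub_cancel_left, Ideal.mem_span_singleton]
      exact h.mul_left _
    exact DFunLike.congr_fun this F)
  refine ⟨⟨g, hs.le hg⟩, hg, fun f => ?_⟩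
  have := H f
  rwa [Ideal.Quotient.mkₐ_eq_mk, Ideal.Quotient.eq, Ideal.mem_span_singleton] at this

end QuotSetup

lemma mem_pointStab_of_forall_dvd {n : ℕ} [Infinite k] {a : Fin n → k} {g : GL (Fin n) k}
    (h : ∀ f, linForm a ∣ matAct g f - f) : g ∈ pointStab (hyp a) := by
  rw [← inv_mem_iff]
  intro x hx
  ext i
  have ⟨q, hq⟩ := h (X i)
  have h1 := congrArg (eval x) hq
  rw [map_mul, eval_linForm, mem_hyp.mp hx, zero_mul, map_sub, eval_matAct, eval_X, eval_X] at h1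
  exact sub_eq_zero.mp h1

/-- A nontrivial element of finite order acting trivially modulo a prime `π` is a reflection, and
`π` defines its hyperplane. -/
lemma exists_associated_linForm {n : ℕ} [CharZero k] {π : MvPolynomial (Fin n) k} (hπ : Prime π)
    {g : GL (Fin n) k} (hg : IsOfFinOrder g) (hg1 : g ≠ 1) (h : ∀ f, π ∣ matAct g f - f) :
    ∃ a : Fin n → k, a ≠ 0 ∧ Associated (linForm a) π ∧
      IsReflection (g : Matrix (Fin n) (Fin n) k) ∧
      hyp a = LinearMap.ker (toLin' (g : Matrix (Fin n) (Fin n) k) - LinearMap.id) := by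
  have hrow (b : Fin n → k) : π ∣ linForm (b ᵥ* (g : Matrix (Fin n) (Fin n) k) - b) := by
    have h1 := h (matAct g⁻¹ (linForm b))
    rw [matAct_matAct_inv, matAct_linForm, inv_inv] at h1
    rw [linForm_sub, ← neg_sub]
    exact h1.neg_right
  obtain ⟨b, hb⟩ : ∃ b : Fin n → k, b ᵥ* (g : Matrix (Fin n) (Fin n) k) - b ≠ 0 := by
    by_contra! H
    refine hg1 (Units.ext ?_)
    exact QuotSetup.eq_of_forall_vecMul fun b => by
      rw [sub_eq_zero.mp (H b), Units.val_one, vecMul_one]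
  set a := b ᵥ* (g : Matrix (Fin n) (Fin n) k) - b with ha
  have hπa : Associated (linForm a) π :=
    (hπ.associated_of_dvd (prime_linForm hb) (hrow b)).symm
  obtain ⟨r, hr⟩ : ∃ r, (g : Matrix (Fin n) (Fin n) k) = 1 + vecMulVec r a :=
    exists_eq_one_add_vecMulVec fun b' => exists_of_linForm_dvd hb (hπa.dvd.trans (hrow b'))
  have hr0 : r ≠ 0 := by
    rintro rfl
    exact hg1 (Units.ext (by simpa using hr))
  have hfin : IsOfFinOrder (g : Matrix (Fin n) (Fin n) k) :=
    (Units.coeHom _).isOfFinOrder hg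
  refine ⟨a, hb, hπa, ?_, ?_⟩
  · rw [hr]
    exact isReflection_of_eq hr0 hb (hr ▸ hfin)
  · rw [hr, ker_toLin'_sub_id hr0]

/-! ### The correspondence between reflecting hyperplanes -/

namespace QuotSetup

variable {n m : ℕ} {Wt G : Subgroup (GeneralLinearGroup (Fin n) k)}
  {p : Fin m → MvPolynomial (Fin n) k} {d : Fin m → ℕ} {c : ↥Wt → Fin m → Fin m → k}

lemma linForm_dvd_aeval_linForm [CharZero k] {a : Fin n → k} (ha : a ≠ 0) {b : Fin m → k} :
    linForm a ∣ aeval p (linForm b) ↔ ∀ x ∈ hyp a, pMap p x ∈ hyp b := by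
  rw [linForm_dvd_iff ha]
  simp only [eval_aeval_linForm, mem_hyp]

lemma c_mul_of_mem [CharZero k] (hs : QuotSetup Wt G p d c) (w : Wt) {g : Wt}
    (hg : (g : GL (Fin n) k) ∈ G) : of (c (w * g)) = of (c w) := by
  rw [hs.c_mul, hs.c_eq_one hg, one_mul]

lemma ne_zero_of_notMem [CharZero k] (hs : QuotSetup Wt G p d c) {w : Wt} {r b : Fin m → k}
    (hw : of (c w) = 1 + vecMulVec r b) (hG : (w : GL (Fin n) k) ∉ G) : r ≠ 0 ∧ b ≠ 0 := by
  constructor <;>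
  · rintro rfl
    exact hG (hs.mem_of_c_eq_one (by simpa using hw))

lemma notMem_of_c_eq [CharZero k] (hs : QuotSetup Wt G p d c) {w : Wt} {r b : Fin m → k}
    (hw : of (c w) = 1 + vecMulVec r b) (hbr : b ⬝ᵥ r ≠ 0) : (w : GL (Fin n) k) ∉ G := by
  intro h
  rw [hs.c_eq_one h, left_eq_add] at hw
  have := vecMulVec_mulVec' r b r
  rw [hw, zero_mulVec, eq_comm, smul_eq_zero] at this
  rcases this with h | rfl
  · exact hbr h
  · exact hbr (dotProduct_zero _)

lemma hyp_eq_of_c_eq [CharZero k] (hs : QuotSetup Wt G p d c) {w : Wt} {r b s b' : Fin m → k}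
    (hw : of (c w) = 1 + vecMulVec r b) (hw' : of (c w) = 1 + vecMulVec s b')
    (hG : (w : GL (Fin n) k) ∉ G) : hyp b = hyp b' := by
  rw [← ker_toLin'_sub_id (hs.ne_zero_of_notMem hw hG).1 b, ← hw, hw',
    ker_toLin'_sub_id (hs.ne_zero_of_notMem hw' hG).1]

lemma exists_mul_mem_pointStab [CharZero k] (hs : QuotSetup Wt G p d c) {w : Wt}
    {r b : Fin m → k} (hw : of (c w) = 1 + vecMulVec r b) {a : Fin n → k} (ha : a ≠ 0)
    (h : ∀ x ∈ hyp a, pMap p x ∈ hyp b) :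
    ∃ g : Wt, (g : GL (Fin n) k) ∈ G ∧ ((w * g : Wt) : GL (Fin n) k) ∈ pointStab (hyp a) := by
  obtain ⟨g, hg, H⟩ := hs.exists_mem_forall_dvd hw (prime_linForm ha)
    ((linForm_dvd_aeval_linForm ha).mpr h)
  exact ⟨g, hg, mem_pointStab_of_forall_dvd H⟩

lemma forall_exists_c_eq [CharZero k] (hs : QuotSetup Wt G p d c)
    (ht : TrivialConormal Wt p c) {w : Wt} {r b : Fin m → k}
    (hw : of (c w) = 1 + vecMulVec r b) (hbr : b ⬝ᵥ r ≠ 0) {a : Fin n → k} (ha : a ≠ 0)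
    (h : ∀ x ∈ hyp a, pMap p x ∈ hyp b) (u : Wt) (hu : (u : GL (Fin n) k) ∈ pointStab (hyp a)) :
    ∃ s, of (c u) = 1 + vecMulVec s b := by
  obtain ⟨ℓ, hℓ⟩ := hs.exists_vecMulVec_of_mem_pointStab ht ha
  obtain ⟨g, hg, hwg⟩ := hs.exists_mul_mem_pointStab hw ha h
  obtain ⟨s, hs'⟩ := hℓ _ hwg
  obtain ⟨s', hu'⟩ := hℓ u hu
  rw [hs.c_mul_of_mem w hg] at hs'
  have hG := hs.notMem_of_c_eq hw hbr
  obtain ⟨t, -, rfl⟩ := (hyp_eq_iff (hs.ne_zero_of_notMem hw hG).2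
    (hs.ne_zero_of_notMem hs' hG).2).mp (hs.hyp_eq_of_c_eq hw hs' hG)
  exact ⟨t • s', by rw [hu', vecMulVec_smul, smul_vecMulVec]⟩

/-- Existence of the hyperplane attached to a reflecting hyperplane of `W~` whose
pointwise stabilizer is not contained in `G`. -/
lemma exists_mem_reflHypsV [CharZero k] (hs : QuotSetup Wt G p d c)
    (ht : TrivialConormal Wt p c) {a : Fin n → k} (ha : a ≠ 0) (hH : hyp a ∈ reflHyps' Wt G) :
    ∃ K ∈ reflHypsV c, ∀ x ∈ hyp a, pMap p x ∈ K := by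
  obtain ⟨ℓ, hℓ⟩ := hs.exists_vecMulVec_of_mem_pointStab ht ha
  obtain ⟨u, ⟨huW, hu⟩, huG⟩ := SetLike.not_le_iff_exists.mp hH.2
  obtain ⟨r, hr⟩ := hℓ ⟨u, huW⟩ hu
  obtain ⟨hr0, hℓ0⟩ := hs.ne_zero_of_notMem hr huG
  refine ⟨_, hs.hyp_mem_reflHypsV hr0 hℓ0 hr, fun x hx => ?_⟩
  rw [← ker_toLin'_sub_id hr0, ← hr]
  simp [hs.mulVec_pMap_of_mem_pointStab (u := ⟨u, huW⟩) hu hx]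

lemma eq_of_mem_reflHypsV [CharZero k] (hs : QuotSetup Wt G p d c)
    (ht : TrivialConormal Wt p c) {a : Fin n → k} (ha : a ≠ 0)
    {K K' : Submodule k (Fin m → k)} (hK : K ∈ reflHypsV c) (hK' : K' ∈ reflHypsV c)
    (h : ∀ x ∈ hyp a, pMap p x ∈ K) (h' : ∀ x ∈ hyp a, pMap p x ∈ K') : K = K' := by
  obtain ⟨w, r, b, hbr, hw, rfl⟩ := exists_of_mem_reflHypsV hK
  obtain ⟨w', r', b', hbr', hw', rfl⟩ := exists_of_mem_reflHypsV hK'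
  obtain ⟨g, hg, hwg⟩ := hs.exists_mul_mem_pointStab hw ha h
  obtain ⟨s, hs'⟩ := hs.forall_exists_c_eq ht hw' hbr' ha h' _ hwg
  rw [hs.c_mul_of_mem w hg] at hs'
  exact hs.hyp_eq_of_c_eq hw hs' (hs.notMem_of_c_eq hw hbr)

/-- The image in `W` of the pointwise stabilizer of a hyperplane of `V~` depends only on the
corresponding hyperplane of `V`. -/
lemma image_pointStab_eq [CharZero k] (hs : QuotSetup Wt G p d c)
    (ht : TrivialConormal Wt p c) {w : Wt} {r b : Fin m → k}
    (hw : of (c w) = 1 + vecMulVec r b) (hbr : b ⬝ᵥ r ≠ 0) {a : Fin n → k} (ha : a ≠ 0)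
    (h : ∀ x ∈ hyp a, pMap p x ∈ hyp b) :
    {x | ∃ g ∈ G, ∃ u ∈ Wt ⊓ pointStab (hyp a), x = g * u}
      = {x | ∃ v : Wt, (v : GL (Fin n) k) = x ∧ ∃ s, of (c v) = 1 + vecMulVec s b} := by
  ext x
  constructor
  · rintro ⟨g, hg, u, ⟨huW, hu⟩, rfl⟩
    obtain ⟨s, hs'⟩ := hs.forall_exists_c_eq ht hw hbr ha h ⟨u, huW⟩ hu
    refine ⟨⟨g, hs.le hg⟩ * ⟨u, huW⟩, rfl, s, ?_⟩
    rw [hs.c_mul, hs.c_eq_one (w := ⟨g, hs.le hg⟩) hg, mul_one, hs']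
  · rintro ⟨v, rfl, s, hv⟩
    obtain ⟨g, hg, hvg⟩ := hs.exists_mul_mem_pointStab hv ha h
    refine ⟨v * (g : GL (Fin n) k)⁻¹ * (v : GL (Fin n) k)⁻¹,
      hs.normal _ v.2 _ (inv_mem hg), _, ⟨(v * g).2, hvg⟩, ?_⟩
    simp

lemma eq_iff_imageEq [CharZero k] (hs : QuotSetup Wt G p d c)
    (ht : TrivialConormal Wt p c) {a a' : Fin n → k} (ha : a ≠ 0) (ha' : a' ≠ 0)
    {K K' : Submodule k (Fin m → k)} (hK : K ∈ reflHypsV c) (hK' : K' ∈ reflHypsV c)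
    (h : ∀ x ∈ hyp a, pMap p x ∈ K) (h' : ∀ x ∈ hyp a', pMap p x ∈ K') :
    K = K' ↔ imageEq Wt G (hyp a) (hyp a') := by
  obtain ⟨w, r, b, hbr, hw, rfl⟩ := exists_of_mem_reflHypsV hK
  obtain ⟨w', r', b', hbr', hw', rfl⟩ := exists_of_mem_reflHypsV hK'
  constructor
  · intro hKK
    rw [imageEq, hs.image_pointStab_eq ht hw hbr ha h,
      hs.image_pointStab_eq ht hw hbr ha' (fun x hx => hKK ▸ h' x hx)]
  · intro H
    rw [imageEq, hs.image_pointStab_eq ht hw hbr ha h,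
      hs.image_pointStab_eq ht hw' hbr' ha' h'] at H
    obtain ⟨v, hv, s, hs'⟩ := H.subset ⟨w, rfl, r, hw⟩
    rw [Subtype.ext hv] at hs'
    exact hs.hyp_eq_of_c_eq hw hs' (hs.notMem_of_c_eq hw hbr)

/-- Every prime factor of the form defining a reflecting hyperplane `K` of `W` defines a
reflecting hyperplane of `W~` mapped into `K`. -/
lemma exists_hyp_of_prime_dvd [CharZero k] (hs : QuotSetup Wt G p d c) {w : Wt}
    {r b : Fin m → k} (hw : of (c w) = 1 + vecMulVec r b) (hbr : b ⬝ᵥ r ≠ 0)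
    {π : MvPolynomial (Fin n) k} (hπ : Prime π) (h : π ∣ aeval p (linForm b)) :
    ∃ a : Fin n → k, a ≠ 0 ∧ Associated (linForm a) π ∧ hyp a ∈ reflHyps' Wt G ∧
      ∀ x ∈ hyp a, pMap p x ∈ hyp b := by
  have := hs.finite_group
  obtain ⟨g, hg, H⟩ := hs.exists_mem_forall_dvd hw hπ h
  have hG : ((w * g : Wt) : GL (Fin n) k) ∉ G :=
    hs.notMem_of_c_eq ((hs.c_mul_of_mem w hg).trans hw) hbr
  obtain ⟨a, ha, hπa, hrefl, hker⟩ := exists_associated_linForm hπ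
    (Wt.subtype.isOfFinOrder (isOfFinOrder_of_finite (w * g)))
    (fun h1 => hG (by rw [show ((w * g : Wt) : GL (Fin n) k) = 1 from h1]; exact one_mem G)) H
  refine ⟨a, ha, hπa, ⟨⟨_, (w * g).2, hrefl, hker⟩, fun hle => hG (hle ⟨(w * g).2, ?_⟩)⟩,
    (linForm_dvd_aeval_linForm ha).mp (hπa.dvd.trans h)⟩
  exact mem_pointStab_of_forall_dvd fun f => hπa.dvd.trans (H f)

lemma aeval_linForm_not_isUnit [CharZero k] (hs : QuotSetup Wt G p d c) (b : Fin m → k) :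
    ¬ IsUnit (aeval p (linForm b)) := by
  intro h
  have hp0 : pMap p 0 = 0 := by
    ext i
    have h := (hs.homog i).coeff_eq_zero (d := 0) (by simpa using (hs.dpos i).ne)
    simpa [pMap, constantCoeff_eq] using h
  have h1 := h.map (eval (0 : Fin n → k))
  rw [eval_aeval_linForm, hp0, dotProduct_zero] at h1
  exact not_isUnit_zero h1

end QuotSetup

/-! ### Orders of vanishing of invariants along a hyperplane -/

lemma eq_vecMulVec_of_mem_pointStab {n : ℕ} {a : Fin n → k} (ha : a ≠ 0) {g : GL (Fin n) k}
    (hg : g ∈ pointStab (hyp a)) :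
    ∃ r, (g : Matrix (Fin n) (Fin n) k) = 1 + vecMulVec r a := by
  refine exists_eq_one_add_vecMulVec fun b => exists_eq_smul_of_forall ha fun x hx => ?_
  rw [sub_dotProduct, ← dotProduct_mulVec, hg x hx, sub_self]

lemma eq_one_of_vecMul_eq {n : ℕ} [CharZero k] {a : Fin n → k} (ha : a ≠ 0) {g : GL (Fin n) k}
    (hg : g ∈ pointStab (hyp a)) (hfin : IsOfFinOrder g)
    (h : a ᵥ* (g : Matrix (Fin n) (Fin n) k) = a) : g = 1 := by
  obtain ⟨r, hr⟩ := eq_vecMulVec_of_mem_pointStab ha hg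
  have hr0 : r = 0 := by
    by_contra hr0
    have h1 := dotProduct_ne_zero_of_isOfFinOrder hr0 ha
      (hr ▸ (Units.coeHom (Matrix (Fin n) (Fin n) k)).isOfFinOrder hfin)
    rw [hr, vecMul_add, vecMul_one, vecMul_vecMulVec, add_eq_left, smul_eq_zero] at h
    exact h.elim h1 ha
  subst hr0
  exact Units.ext (by simpa using hr)

lemma exists_matAct_linForm_eq {n : ℕ} [Infinite k] {a : Fin n → k} (ha : a ≠ 0)
    {g : GL (Fin n) k} (hg : g ∈ pointStab (hyp a)) :
    ∃ t : k, matAct g (linForm a) = C t * linForm a := by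
  obtain ⟨t, ht⟩ := exists_eq_smul_of_forall
    (b := a ᵥ* (↑(g⁻¹) : Matrix (Fin n) (Fin n) k)) ha fun x hx => by
      rw [← dotProduct_mulVec, (inv_mem hg : g⁻¹ ∈ pointStab (hyp a)) x hx, hx]
  exact ⟨t, by rw [matAct_linForm, ht, linForm_smul]⟩

lemma linForm_dvd_matAct_sub {n : ℕ} [Infinite k] {a : Fin n → k} (ha : a ≠ 0)
    {g : GL (Fin n) k} (hg : g ∈ pointStab (hyp a)) (f : MvPolynomial (Fin n) k) :
    linForm a ∣ matAct g f - f := by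
  refine (linForm_dvd_iff ha _).mpr fun x hx => ?_
  rw [map_sub, eval_matAct, (inv_mem hg : g⁻¹ ∈ pointStab (hyp a)) x hx, sub_self]

/-- An invariant vanishing along a hyperplane `H` vanishes there to order at least `e_H`. -/
lemma linForm_pow_eH_dvd {n : ℕ} [CharZero k] (G : Subgroup (GL (Fin n) k)) [Finite G]
    {a : Fin n → k} (ha : a ≠ 0) {f : MvPolynomial (Fin n) k} (hf : f ∈ invariants G)
    (h : linForm a ∣ f) : linForm a ^ eH G (hyp a) ∣ f := by
  classical
  rcases eq_or_ne f 0 with rfl | hf0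
  · exact dvd_zero _
  have hπ := prime_linForm ha
  obtain ⟨q, hfq, hq⟩ := (FiniteMultiplicity.of_prime_left hπ hf0).exists_eq_pow_mul_and_not_dvd
  set r := multiplicity (linForm a) f with hr
  have hr0 : 0 < r := by
    refine Nat.pos_of_ne_zero fun h0 => hq ?_
    rw [h0, pow_zero, one_mul] at hfq
    exact hfq ▸ h
  have : Finite ↥(G ⊓ pointStab (hyp a)) :=
    Finite.of_injective _ (Subgroup.inclusion_injective (inf_le_left : _ ≤ G))
  have := Fintype.ofFinite ↥(G ⊓ pointStab (hyp a))
  have hχ (s : ↥(G ⊓ pointStab (hyp a))) :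
      ∃ t : k, matAct (s : GL (Fin n) k) (linForm a) = C t * linForm a :=
    exists_matAct_linForm_eq ha s.2.2
  choose χ hχ using hχ
  have hinj : Function.Injective χ := by
    intro s s' hss
    have h1 : matAct ((s'⁻¹ * s : ↥(G ⊓ pointStab (hyp a))) : GL (Fin n) k) (linForm a)
        = linForm a := by
      rw [Subgroup.coe_mul, matAct_mul, hχ s, hss, ← hχ s', Subgroup.coe_inv,
        matAct_inv_matAct]
    rw [matAct_linForm] at h1
    have h2 := eq_one_of_vecMul_eq ha (inv_mem (s'⁻¹ * s).2.2)
      ((Subgroup.subtype _).isOfFinOrder (isOfFinOrder_of_finite (s'⁻¹ * s))).inv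
      (linForm_injective h1)
    rw [inv_eq_one] at h2
    exact (inv_mul_eq_one.mp (Subtype.ext h2)).symm
  have hroot (s) : χ s ^ r = 1 := by
    have h1 := hf s s.2.1
    rw [hfq, map_mul, map_pow, hχ, mul_pow, mul_assoc, mul_left_comm] at h1
    have h2 := mul_left_cancel₀ (pow_ne_zero _ hπ.ne_zero) h1
    rw [← C_pow] at h2
    have h3 := linForm_dvd_matAct_sub ha s.2.2 q
    by_contra hne
    refine hq ?_
    have h4 : linForm a ∣ C (χ s ^ r - 1) * q := by
      have : C (χ s ^ r - 1) * q
          = - (C (χ s ^ r) * (matAct (s : GL (Fin n) k) q - q)) := by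
        rw [mul_sub, h2, C_sub, C_1]
        ring
      rw [this]
      exact (h3.mul_left _).neg_right
    have hu : IsUnit (C (χ s ^ r - 1) : MvPolynomial (Fin n) k) :=
      (isUnit_iff_ne_zero.mpr (sub_ne_zero.mpr hne)).map C
    exact (hu.dvd_mul_left).mp h4
  have hcard : eH G (hyp a) ≤ r := by
    rw [eH, Nat.card_eq_fintype_card, ← Finset.card_univ,
      ← Finset.card_image_of_injective _ hinj]
    refine (Finset.card_le_card (t := (Polynomial.nthRoots r (1 : k)).toFinset) ?_).trans
      ((Multiset.toFinset_card_le _).trans (Polynomial.card_nthRoots r 1))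
    intro x hx
    obtain ⟨s, -, rfl⟩ := Finset.mem_image.mp hx
    rw [Multiset.mem_toFinset, Polynomial.mem_nthRoots hr0]
    exact hroot s
  rw [hfq]
  exact (pow_dvd_pow _ hcard).mul_right _

lemma matAct_pow_eH {n : ℕ} [Infinite k] (G : Subgroup (GL (Fin n) k))
    {a : Fin n → k} (ha : a ≠ 0) {g : GL (Fin n) k} (hg : g ∈ G ⊓ pointStab (hyp a)) :
    matAct g (linForm a ^ eH G (hyp a)) = linForm a ^ eH G (hyp a) := by
  obtain ⟨t, ht⟩ := exists_matAct_linForm_eq ha hg.2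
  have hpow (j : ℕ) : matAct (g ^ j) (linForm a) = C (t ^ j) * linForm a := by
    induction j with
    | zero => simp [matAct_one]
    | succ j ih =>
      rw [pow_succ', matAct_mul, ih, map_mul, ht, algHom_C, algebraMap_eq, ← mul_assoc, ← C_mul,
        pow_succ]
  have h1 : g ^ eH G (hyp a) = 1 :=
    congrArg Subtype.val (pow_card_eq_one' (x := (⟨g, hg⟩ : ↥(G ⊓ pointStab (hyp a)))))
  have h2 := hpow (eH G (hyp a))
  rw [h1, matAct_one] at h2
  have h3 : (C (t ^ eH G (hyp a)) : MvPolynomial (Fin n) k) = 1 :=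
    mul_right_cancel₀ (linForm_ne_zero ha) (h2.symm.trans (one_mul _).symm)
  rw [map_pow, ht, mul_pow, ← C_pow, h3, one_mul]

/-- Some invariant vanishes along a hyperplane `H` to order exactly `e_H`. -/
lemma exists_mem_invariants_pow_eH {n : ℕ} [CharZero k] (G : Subgroup (GL (Fin n) k)) [Finite G]
    {a : Fin n → k} (ha : a ≠ 0) :
    ∃ f ∈ invariants G, linForm a ^ eH G (hyp a) ∣ f ∧
      ¬ linForm a ^ (eH G (hyp a) + 1) ∣ f := by
  classical
  have := Fintype.ofFinite G
  have hπ := prime_linForm ha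
  set e := eH G (hyp a) with he
  obtain ⟨z, hz⟩ := exists_dotProduct_eq_one ha
  let T : Finset G := {h | ¬ linForm a ∣ matAct (h : GL (Fin n) k) (linForm a)}
  let w : MvPolynomial (Fin n) k := ∏ h ∈ T, matAct (h : GL (Fin n) k)⁻¹ (linForm a) ^ e
  have hw : ¬ linForm a ∣ w := by
    intro h
    obtain ⟨g, hg, h⟩ := (hπ.dvd_finsetProd_iff _).mp h
    have h1 := hπ.dvd_of_dvd_pow h
    rw [matAct_linForm] at h1
    obtain ⟨t, ht⟩ := exists_of_linForm_dvd ha h1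
    have ht0 : t ≠ 0 := by
      rintro rfl
      rw [zero_smul] at ht
      refine matAct_ne_zero (g : GL (Fin n) k)⁻¹ (linForm_ne_zero ha) ?_
      rw [matAct_linForm, ht, linForm_zero]
    refine (Finset.mem_filter.mp hg).2 ?_
    rw [← inv_inv (g : GL (Fin n) k), ← matAct_dvd_iff, matAct_linForm, ht, linForm_smul]
    exact ((isUnit_iff_ne_zero.mpr ht0).map C).mul_left_dvd.mpr dvd_rfl
  have hκ (g : G) : ∃ q, matAct (g : GL (Fin n) k) (linForm a ^ e * w) = linForm a ^ e * q := by
    change linForm a ^ e ∣ _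
    rw [map_mul, map_pow]
    by_cases h : linForm a ∣ matAct (g : GL (Fin n) k) (linForm a)
    · exact (pow_dvd_pow_of_dvd h e).mul_right _
    · refine Dvd.dvd.mul_left ?_ _
      have h1 : matAct (g : GL (Fin n) k) (matAct (g : GL (Fin n) k)⁻¹ (linForm a) ^ e)
          = linForm a ^ e := by rw [map_pow, matAct_matAct_inv]
      rw [← h1]
      exact map_dvd _ (Finset.dvd_prod_of_mem
        (fun h : G => matAct (h : GL (Fin n) k)⁻¹ (linForm a) ^ e)
        (Finset.mem_filter.mpr ⟨Finset.mem_univ _, h⟩))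
  choose κ hκ using hκ
  by_contra! H
  let σ : G → MvPolynomial (Fin n) k →* MvPolynomial (Fin n) k := fun g =>
    ((restr a z).comp (matAct (g : GL (Fin n) k)) : MvPolynomial (Fin n) k →ₐ[k] _)
  have hσ (u : MvPolynomial (Fin n) k) : ∑ g : G, restr a z (κ g) * σ g u = 0 := by
    have h1 : ∑ g : G, matAct (g : GL (Fin n) k) (linForm a ^ e * w * u)
        = linForm a ^ e * ∑ g : G, κ g * matAct (g : GL (Fin n) k) u := by
      rw [Finset.mul_sum]
      exact Finset.sum_congr rfl fun g _ => by rw [map_mul, hκ, mul_assoc]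
    have h2 := H _ (sum_matAct_mem_invariants G (linForm a ^ e * w * u))
      (h1 ▸ dvd_mul_right _ _)
    rw [h1, pow_succ] at h2
    have h3 := (mul_dvd_mul_iff_left (pow_ne_zero _ hπ.ne_zero)).mp h2
    rw [← restr_eq_zero_iff hz, map_sum] at h3
    rw [← h3]
    exact Finset.sum_congr rfl fun g _ => by rw [map_mul]; rfl
  have hfib : ∑ g : G with σ g = σ 1, restr a z (κ g) = 0 := by
    refine linearIndependent_iff'.mp (linearIndependent_monoidHom (MvPolynomial (Fin n) k)
      (MvPolynomial (Fin n) k)) (Finset.univ.image σ)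
      (fun τ => ∑ g : G with σ g = τ, restr a z (κ g)) ?_ (σ 1)
      (Finset.mem_image_of_mem _ (Finset.mem_univ _))
    ext1 u
    rw [Finset.sum_apply, Pi.zero_apply, ← hσ u,
      ← Finset.sum_fiberwise_of_maps_to (t := Finset.univ.image σ) (g := σ)
        fun g _ => Finset.mem_image_of_mem _ (Finset.mem_univ g)]
    refine Finset.sum_congr rfl fun τ _ => ?_
    rw [Pi.smul_apply, smul_eq_mul, Finset.sum_mul]
    refine Finset.sum_congr rfl fun g hg => ?_
    rw [(Finset.mem_filter.mp hg).2]
  have hval (g : G) (hg : σ g = σ 1) : restr a z (κ g) = restr a z w := by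
    have hdvd (f) : linForm a ∣ matAct (g : GL (Fin n) k) f - f := by
      have h1 : restr a z (matAct (g : GL (Fin n) k) f) = restr a z (matAct 1 f) :=
        DFunLike.congr_fun hg f
      rw [← restr_eq_zero_iff hz, map_sub, h1, matAct_one, sub_self]
    have h1 := hκ g
    rw [map_mul, matAct_pow_eH G ha ⟨g.2, mem_pointStab_of_forall_dvd hdvd⟩] at h1
    rw [← mul_left_cancel₀ (pow_ne_zero _ hπ.ne_zero) h1, ← sub_eq_zero, ← map_sub,
      restr_eq_zero_iff hz]
    exact hdvd w
  rw [Finset.sum_congr rfl fun g hg => hval g (Finset.mem_filter.mp hg).2, Finset.sum_const,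
    smul_eq_zero, Finset.card_eq_zero] at hfib
  refine hfib.elim (fun h => ?_) fun h => hw ((restr_eq_zero_iff hz _).mp h)
  exact Finset.notMem_empty (1 : G) (h ▸ Finset.mem_filter.mpr ⟨Finset.mem_univ _, rfl⟩)

namespace QuotSetup

variable {n m : ℕ} {Wt G : Subgroup (GeneralLinearGroup (Fin n) k)}
  {p : Fin m → MvPolynomial (Fin n) k} {d : Fin m → ℕ} {c : ↥Wt → Fin m → Fin m → k}

/-- The form defining a reflecting hyperplane of `W` vanishes to order at most `e_H` along a
hyperplane `H` of `V~`. -/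
lemma not_pow_eH_succ_dvd [CharZero k] (hs : QuotSetup Wt G p d c)
    (ht : TrivialConormal Wt p c) {w : Wt} {r b : Fin m → k}
    (hw : of (c w) = 1 + vecMulVec r b) (hbr : b ⬝ᵥ r ≠ 0) {a : Fin n → k} (ha : a ≠ 0) :
    ¬ linForm a ^ (eH G (hyp a) + 1) ∣ aeval p (linForm b) := by
  intro h
  have := hs.finite_normal
  have h0 : linForm a ∣ aeval p (linForm b) := (dvd_pow_self _ (Nat.succ_ne_zero _)).trans h
  obtain ⟨f, hf, hfd, hfn⟩ := exists_mem_invariants_pow_eH G ha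
  obtain ⟨F, rfl⟩ := hs.exists_aeval_eq hf
  have heH : eH G (hyp a) ≠ 0 := by
    have : Finite ↥(G ⊓ pointStab (hyp a)) :=
      Finite.of_injective _ (Subgroup.inclusion_injective (inf_le_left : _ ≤ G))
    exact Nat.card_pos.ne'
  obtain ⟨x, hx, β, γ, hβ, hγ, H⟩ := hs.exists_jet_relation ht ha
    ((dvd_pow_self _ heH).trans hfd) h0 (fun h1 => hfn (h1 ▸ dvd_zero _)) (fun j hj => by
      refine (pow_dvd_pow _ ?_).trans h
      by_contra! hlt
      exact hfn ((pow_dvd_pow _ hlt.le).trans hj))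
  rw [hγ _ h hfn] at H
  obtain ⟨g, hg, hwg⟩ := hs.exists_mul_mem_pointStab hw ha ((linForm_dvd_aeval_linForm ha).mp h0)
  have h1 := H _ hwg r
  rw [hs.c_mul_of_mem w hg, snd_jet_linForm, snd_jet_linForm, hw, add_mulVec, one_mulVec,
    vecMulVec_mulVec', dotProduct_add, dotProduct_smul, add_sub_cancel_left, zero_mul,
    smul_eq_mul] at h1
  exact mul_ne_zero hβ (mul_ne_zero hbr hbr) h1

end QuotSetup

/-! ### Linear forms defining the reflecting hyperplanes of `W` -/

lemma finite_reflHyps {n : ℕ} {W : Subgroup (GL (Fin n) k)} (hW : (W : Set (GL (Fin n) k)).Finite) :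
    (reflHyps W).Finite := by
  refine (hW.image fun g : GL (Fin n) k => LinearMap.ker
    (toLin' (g : Matrix (Fin n) (Fin n) k) - LinearMap.id)).subset ?_
  rintro H ⟨g, hg, -, rfl⟩
  exact ⟨g, hg, rfl⟩

namespace QuotSetup

variable {n m : ℕ} {Wt G : Subgroup (GeneralLinearGroup (Fin n) k)}
  {p : Fin m → MvPolynomial (Fin n) k} {d : Fin m → ℕ} {c : ↥Wt → Fin m → Fin m → k}
  {α : Submodule k (Fin n → k) → MvPolynomial (Fin n) k}

lemma exists_aeval_linForm_eq_finprod [CharZero k] (hs : QuotSetup Wt G p d c)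
    (ht : TrivialConormal Wt p c)
    (hα : ∀ H ∈ reflHyps Wt, (α H).IsHomogeneous 1 ∧
      ∀ x : Fin n → k, eval x (α H) = 0 ↔ x ∈ H)
    {w : Wt} {r b : Fin m → k} (hw : of (c w) = 1 + vecMulVec r b) (hbr : b ⬝ᵥ r ≠ 0) :
    ∃ t : k, t ≠ 0 ∧ aeval p (linForm b) = C t *
      ∏ᶠ Ht ∈ {Ht | Ht ∈ reflHyps' Wt G ∧ ∀ x ∈ Ht, pMap p x ∈ hyp b}, α Ht ^ eH G Ht := by
  classical
  have := hs.finite_normal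
  have hfin : {Ht | Ht ∈ reflHyps' Wt G ∧ ∀ x ∈ Ht, pMap p x ∈ hyp b}.Finite :=
    (finite_reflHyps hs.finite).subset fun H hH => hH.1.1
  rw [finprod_mem_eq_finite_toFinset_prod _ hfin]
  set S := hfin.toFinset with hS
  have hSmem {H} : H ∈ S ↔ H ∈ reflHyps' Wt G ∧ ∀ x ∈ H, pMap p x ∈ hyp b := by
    rw [hS, Set.Finite.mem_toFinset, Set.mem_ofPred_eq]
  have hform (H) (hH : H ∈ S) : ∃ a, a ≠ 0 ∧ α H = linForm a ∧ H = hyp a :=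
    have h1 := (hSmem.mp hH).1.1
    exists_of_mem_reflHyps h1 (hα H h1).1 (hα H h1).2
  have hrel : (S : Set (Submodule k (Fin n → k))).Pairwise
      (Function.onFun IsRelPrime fun H => α H ^ eH G H) := by
    intro H hH H' hH' hne
    obtain ⟨a, ha, hαa, hHa⟩ := hform H hH
    obtain ⟨a', ha', hαa', hHa'⟩ := hform H' hH'
    refine IsRelPrime.pow ?_
    rw [hαa, hαa', (prime_linForm ha).irreducible.isRelPrime_iff_not_dvd]
    intro h
    obtain ⟨t, rfl⟩ := exists_of_linForm_dvd ha h
    refine hne (hHa.trans (((hyp_eq_iff ha ha').mpr ⟨t, ?_, rfl⟩).trans hHa'.symm))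
    rintro rfl
    exact ha' (zero_smul _ _)
  have hdvd (H) (hH : H ∈ S) : α H ^ eH G H ∣ aeval p (linForm b) := by
    obtain ⟨a, ha, hαa, rfl⟩ := hform H hH
    rw [hαa]
    exact linForm_pow_eH_dvd G ha (hs.aeval_mem _)
      ((linForm_dvd_aeval_linForm ha).mpr (hSmem.mp hH).2)
  obtain ⟨R, hR⟩ := Finset.prod_dvd_of_isRelPrime hrel hdvd
  have hb : b ≠ 0 := by
    rintro rfl
    exact hbr (zero_dotProduct r)
  have hR0 : R ≠ 0 := by
    rintro rfl
    exact hb (hs.eq_zero_of_aeval_linForm (hR.trans (mul_zero _)))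
  have hRu : IsUnit R := by
    by_contra hRu
    obtain ⟨π, hπ, hπR⟩ := WfDvdMonoid.exists_irreducible_factor hRu hR0
    obtain ⟨a, ha, hπa, hH, hK⟩ := hs.exists_hyp_of_prime_dvd hw hbr hπ.prime
      (hR ▸ hπR.mul_left _)
    have hHS : hyp a ∈ S := hSmem.mpr ⟨hH, hK⟩
    obtain ⟨a', ha', hαa, hHa⟩ := hform _ hHS
    refine hs.not_pow_eH_succ_dvd ht hw hbr ha' ?_
    obtain ⟨t, ht0, rfl⟩ := (hyp_eq_iff ha' ha).mp hHa.symm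
    rw [hR, pow_succ, ← hHa, ← hαa]
    refine mul_dvd_mul (Finset.dvd_prod_of_mem (fun H => α H ^ eH G H) hHS) ?_
    rw [hαa]
    refine Dvd.dvd.trans ?_ (hπa.dvd.trans hπR)
    rw [linForm_smul]
    exact dvd_mul_left _ _
  obtain ⟨t, htu, rfl⟩ := MvPolynomial.isUnit_iff_eq_C_of_isReduced.mp hRu
  exact ⟨t, htu.ne_zero, by rw [hR, mul_comm]⟩

lemma exists_linForm_aeval_eq_finprod [CharZero k] (hs : QuotSetup Wt G p d c)
    (ht : TrivialConormal Wt p c)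
    (hα : ∀ H ∈ reflHyps Wt, (α H).IsHomogeneous 1 ∧
      ∀ x : Fin n → k, eval x (α H) = 0 ↔ x ∈ H)
    {K : Submodule k (Fin m → k)} (hK : K ∈ reflHypsV c) :
    ∃ αK : MvPolynomial (Fin m) k,
        αK.IsHomogeneous 1 ∧ (∀ v : Fin m → k, eval v αK = 0 ↔ v ∈ K) ∧
        aeval p αK =
          ∏ᶠ Ht ∈ {Ht | Ht ∈ reflHyps' Wt G ∧ ∀ x ∈ Ht, pMap p x ∈ K},
            α Ht ^ eH G Ht := by
  obtain ⟨w, r, b, hbr, hw, rfl⟩ := exists_of_mem_reflHypsV hK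
  obtain ⟨t, ht0, h⟩ := hs.exists_aeval_linForm_eq_finprod ht hα hw hbr
  refine ⟨linForm (t⁻¹ • b), isHomogeneous_linForm _, fun v => ?_, ?_⟩
  · rw [eval_linForm, smul_dotProduct, smul_eq_zero, mem_hyp, inv_eq_zero, or_iff_right ht0]
  · rw [linForm_smul, map_mul, h, algHom_C, algebraMap_eq, ← mul_assoc, ← C_mul,
      inv_mul_cancel₀ ht0, C_1, one_mul]

lemma exists_hyp_of_mem_reflHypsV [CharZero k] (hs : QuotSetup Wt G p d c)
    {K : Submodule k (Fin m → k)} (hK : K ∈ reflHypsV c) :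
    ∃ Ht ∈ reflHyps' Wt G, ∀ x ∈ Ht, pMap p x ∈ K := by
  obtain ⟨w, r, b, hbr, hw, rfl⟩ := exists_of_mem_reflHypsV hK
  have hb : b ≠ 0 := by
    rintro rfl
    exact hbr (zero_dotProduct r)
  obtain ⟨π, hπ, hπb⟩ := WfDvdMonoid.exists_irreducible_factor (hs.aeval_linForm_not_isUnit b)
    fun h => hb (hs.eq_zero_of_aeval_linForm h)
  obtain ⟨a, -, -, hH, h⟩ := hs.exists_hyp_of_prime_dvd hw hbr hπ.prime hπb
  exact ⟨hyp a, hH, h⟩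

/-- The linear forms on `V` whose restriction to `V~/G` lies in a given subspace. -/
def formsInto (p : Fin m → MvPolynomial (Fin n) k) (S : Submodule k (MvPolynomial (Fin n) k)) :
    Submodule k (Fin m → k) where
  carrier := {b | aeval p (linForm b) ∈ S}
  add_mem' hb hb' := by
    rw [Set.mem_ofPred_eq, linForm_add, map_add]
    exact add_mem hb hb'
  zero_mem' := by simp [linForm_zero]
  smul_mem' t b hb := by
    rw [Set.mem_ofPred_eq, linForm_smul, map_mul, algHom_C, ← Algebra.smul_def]
    exact S.smul_mem t hb

lemma mem_formsInto {S : Submodule k (MvPolynomial (Fin n) k)} {b : Fin m → k} :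
    b ∈ formsInto p S ↔ aeval p (linForm b) ∈ S := Iff.rfl

/-- If a subspace of `V^*` contains all the differences `s b - b` for `s` a reflection of `W~`, it
contains all the differences `w b - b` for `w` in `W~`. -/
lemma vecMul_sub_mem [Infinite k] (hs : QuotSetup Wt G p d c) {U : Submodule k (Fin m → k)}
    (h : ∀ s : Wt, IsReflection ((s : GL (Fin n) k) : Matrix (Fin n) (Fin n) k) →
      ∀ b : Fin m → k, b ᵥ* of (c s) - b ∈ U) (w : Wt) (b : Fin m → k) :
    b ᵥ* of (c w) - b ∈ U := by
  obtain ⟨w, hw⟩ := w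
  have hle : Subgroup.closure {g | g ∈ Wt ∧ IsReflection ((g : Matrix (Fin n) (Fin n) k))} ≤ Wt :=
    hs.reflGroup.le
  have hw' := hw
  rw [← hs.reflGroup] at hw'
  induction hw' using Subgroup.closure_induction generalizing b with
  | mem g hg => exact h ⟨g, hg.1⟩ hg.2 b
  | one =>
    rw [show (⟨1, hw⟩ : Wt) = 1 from rfl, hs.c_one, vecMul_one, sub_self]
    exact zero_mem U
  | mul x y hx hy ihx ihy =>
    rw [show (⟨x * y, hw⟩ : Wt) = ⟨x, hle hx⟩ * ⟨y, hle hy⟩ from rfl, hs.c_mul, ← vecMul_vecMul]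
    simpa using add_mem (ihx (b ᵥ* of (c ⟨y, hle hy⟩)) (hle hx)) (ihy b (hle hy))
  | inv x hx ih =>
    have h1 := ih (b ᵥ* of (c ⟨x⁻¹, hw⟩)) (hle hx)
    rw [vecMul_vecMul, ← hs.c_mul, show (⟨x, hle hx⟩ * ⟨x⁻¹, hw⟩ : Wt) = 1 from
      Subtype.ext (mul_inv_cancel x), hs.c_one, vecMul_one] at h1
    rw [← neg_sub]
    exact neg_mem h1

lemma adjoin_eq [CharZero k] (hs : QuotSetup Wt G p d c) (ht : TrivialConormal Wt p c)
    (hα : ∀ H ∈ reflHyps Wt, (α H).IsHomogeneous 1 ∧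
      ∀ x : Fin n → k, eval x (α H) = 0 ↔ x ∈ H) :
    Algebra.adjoin k
        ((invariants Wt : Set (MvPolynomial (Fin n) k)) ∪
          {f | ∃ K ∈ reflHypsV c,
            f = ∏ᶠ Ht ∈ {Ht | Ht ∈ reflHyps' Wt G ∧ ∀ x ∈ Ht, pMap p x ∈ K},
              α Ht ^ eH G Ht}) = invariants G := by
  classical
  refine le_antisymm (Algebra.adjoin_le ?_) ?_
  · rintro f (hf | ⟨K, hK, rfl⟩)
    · exact fun g hg => hf g (hs.le hg)
    · obtain ⟨αK, -, -, h⟩ := hs.exists_linForm_aeval_eq_finprod ht hα hK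
      exact h ▸ hs.aeval_mem αK
  set S := Algebra.adjoin k
        ((invariants Wt : Set (MvPolynomial (Fin n) k)) ∪
          {f | ∃ K ∈ reflHypsV c,
            f = ∏ᶠ Ht ∈ {Ht | Ht ∈ reflHyps' Wt G ∧ ∀ x ∈ Ht, pMap p x ∈ K},
              α Ht ^ eH G Ht}) with hS
  have hrefl (s : Wt) (hsr : IsReflection ((s : GL (Fin n) k) : Matrix (Fin n) (Fin n) k))
      (b : Fin m → k) : b ᵥ* of (c s) - b ∈ formsInto p S.toSubmodule := by
    by_cases hsG : (s : GL (Fin n) k) ∈ G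
    · rw [hs.c_eq_one hsG, vecMul_one, sub_self]
      exact zero_mem _
    set H := LinearMap.ker
      (toLin' ((s : GL (Fin n) k) : Matrix (Fin n) (Fin n) k) - LinearMap.id) with hHdef
    have hH : H ∈ reflHyps Wt := ⟨s, s.2, hsr, rfl⟩
    have hsH : (s : GL (Fin n) k) ∈ pointStab H := fun x hx => by
      simpa [hHdef, sub_eq_zero] using hx
    obtain ⟨a, ha, -, hHa⟩ := exists_of_mem_reflHyps hH (hα H hH).1 (hα H hH).2
    rw [hHa] at hsH hH
    obtain ⟨K, hK, hp⟩ := hs.exists_mem_reflHypsV ht ha ⟨hH, fun hle => hsG (hle ⟨s.2, hsH⟩)⟩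
    have hKmem : ∏ᶠ Ht ∈ {Ht | Ht ∈ reflHyps' Wt G ∧ ∀ x ∈ Ht, pMap p x ∈ K},
        α Ht ^ eH G Ht ∈ S := Algebra.subset_adjoin (Or.inr ⟨K, hK, rfl⟩)
    obtain ⟨w, r, b₀, hbr, hw, rfl⟩ := exists_of_mem_reflHypsV hK
    obtain ⟨t, -, h⟩ := hs.exists_aeval_linForm_eq_finprod ht hα hw hbr
    obtain ⟨q, hq⟩ := hs.forall_exists_c_eq ht hw hbr ha hp s hsH
    rw [hq, vecMul_add, vecMul_one, add_sub_cancel_left, vecMul_vecMulVec]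
    refine Submodule.smul_mem _ _ ?_
    rw [mem_formsInto, h, ← algebraMap_eq]
    exact S.mul_mem (S.algebraMap_mem t) hKmem
  rw [← hs.gen]
  refine Algebra.adjoin_le ?_
  rintro _ ⟨i, rfl⟩
  have := hs.finite_group
  have := Fintype.ofFinite Wt
  have hsum : ∑ w : Wt, (Pi.single i (1 : k)) ᵥ* of (c w) ∈ formsInto p S.toSubmodule := by
    have h1 : aeval p (linForm (∑ w : Wt, (Pi.single i (1 : k)) ᵥ* of (c w)))
        = ∑ w : Wt, matAct (w : GL (Fin n) k) (p i) := by
      have (T : Finset Wt) : aeval p (linForm (∑ w ∈ T, (Pi.single i (1 : k)) ᵥ* of (c w)))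
          = ∑ w ∈ T, matAct (w : GL (Fin n) k) (p i) := by
        induction T using Finset.induction_on with
        | empty => simp [linForm_zero]
        | insert w T hwT ih =>
          rw [Finset.sum_insert hwT, Finset.sum_insert hwT, linForm_add, map_add, ih,
            hs.aeval_linForm_vecMul, linForm_single, aeval_X]
      exact this _
    rw [mem_formsInto, h1]
    exact Algebra.subset_adjoin (Or.inl (sum_matAct_mem_invariants Wt (p i)))
  have h2 : (Fintype.card Wt : k) • (Pi.single i 1 : Fin m → k)
      ∈ formsInto p S.toSubmodule := by
    have h3 := sub_mem hsum (sum_mem fun (w : Wt) (_ : w ∈ Finset.univ) =>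
      hs.vecMul_sub_mem hrefl w (Pi.single i (1 : k)))
    rw [← Finset.sum_sub_distrib] at h3
    simpa [Nat.cast_smul_eq_nsmul] using h3
  have h3 := (formsInto p S.toSubmodule).smul_mem (Fintype.card Wt : k)⁻¹ h2
  rw [smul_smul, inv_mul_cancel₀ (Nat.cast_ne_zero.mpr Fintype.card_ne_zero), one_smul,
    mem_formsInto, linForm_single, aeval_X] at h3
  exact h3

end QuotSetup

end Correspondence

/-- hyperplane correspondence. For every `Ht ∈ A'(Wt)` there is a unique
reflecting hyperplane `φ(Ht)` of `W` containing `p(Ht)`; `φ` induces a bijection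
`A'bar(Wt) ≃ A(W)`; for every `H ∈ A(W)` there is a linear form `α_H ∈ A` defining `H`
whose image in `B^G` is `α_{φ⁻¹(H)}`, and `B^G` is generated by `B^{Wt}` together with
the `α_{φ⁻¹(H)}`. -/
theorem statement6 [CharZero k] {n m : ℕ}
    (Wt G : Subgroup (Matrix.GeneralLinearGroup (Fin n) k))
    (p : Fin m → MvPolynomial (Fin n) k) (d : Fin m → ℕ)
    (c : ↥Wt → Fin m → Fin m → k)
    (hsetup : QuotSetup Wt G p d c)
    (hgood : IsGoodQuot Wt p c)
    (α : Submodule k (Fin n → k) → MvPolynomial (Fin n) k)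
    (hα : ∀ H ∈ reflHyps Wt, (α H).IsHomogeneous 1 ∧
      ∀ x : Fin n → k, eval x (α H) = 0 ↔ x ∈ H) :
    -- existence and uniqueness of `φ(Ht)`
    (∀ Ht ∈ reflHyps' Wt G, ∃! K : Submodule k (Fin m → k),
      K ∈ reflHypsV c ∧ ∀ x ∈ Ht, pMap p x ∈ K)
    -- `φ` identifies two hyperplanes exactly when they are equivalent
    ∧ (∀ Ht ∈ reflHyps' Wt G, ∀ Ht' ∈ reflHyps' Wt G,
        ∀ K ∈ reflHypsV c, ∀ K' ∈ reflHypsV c,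
        (∀ x ∈ Ht, pMap p x ∈ K) → (∀ x ∈ Ht', pMap p x ∈ K') →
        (K = K' ↔ imageEq Wt G Ht Ht'))
    -- `φ` is surjective onto `A(W)`
    ∧ (∀ K ∈ reflHypsV c, ∃ Ht ∈ reflHyps' Wt G, ∀ x ∈ Ht, pMap p x ∈ K)
    -- linear forms defining the hyperplanes of `W` with image `α_{φ⁻¹(K)}`
    ∧ (∀ K ∈ reflHypsV c, ∃ αK : MvPolynomial (Fin m) k,
        αK.IsHomogeneous 1 ∧ (∀ v : Fin m → k, eval v αK = 0 ↔ v ∈ K) ∧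
        aeval p αK =
          ∏ᶠ Ht ∈ {Ht | Ht ∈ reflHyps' Wt G ∧ ∀ x ∈ Ht, pMap p x ∈ K},
            α Ht ^ eH G Ht)
    -- `B^G` is generated by `B^{Wt}` and the `α_{φ⁻¹(K)}`
    ∧ Algebra.adjoin k
        ((invariants Wt : Set (MvPolynomial (Fin n) k)) ∪
          {f | ∃ K ∈ reflHypsV c,
            f = ∏ᶠ Ht ∈ {Ht | Ht ∈ reflHyps' Wt G ∧ ∀ x ∈ Ht, pMap p x ∈ K},
              α Ht ^ eH G Ht}) = invariants G := by
  have hform (Ht) (hH : Ht ∈ reflHyps' Wt G) : ∃ a, a ≠ 0 ∧ Ht = hyp a := by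
    obtain ⟨a, ha, -, h⟩ := exists_of_mem_reflHyps hH.1 (hα Ht hH.1).1 (hα Ht hH.1).2
    exact ⟨a, ha, h⟩
  refine ⟨fun Ht hH => ?_, fun Ht hH Ht' hH' K hK K' hK' h h' => ?_,
    fun K hK => hsetup.exists_hyp_of_mem_reflHypsV hK,
    fun K hK => hsetup.exists_linForm_aeval_eq_finprod hgood.2 hα hK,
    hsetup.adjoin_eq hgood.2 hα⟩
  · obtain ⟨a, ha, rfl⟩ := hform Ht hH
    obtain ⟨K, hK, h⟩ := hsetup.exists_mem_reflHypsV hgood.2 ha hH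
    exact ⟨K, ⟨hK, h⟩, fun K' hK' => hsetup.eq_of_mem_reflHypsV hgood.2 ha hK'.1 hK hK'.2 h⟩
  · obtain ⟨a, ha, rfl⟩ := hform Ht hH
    obtain ⟨a', ha', rfl⟩ := hform Ht' hH'
    exact hsetup.eq_iff_imageEq hgood.2 ha ha' hK hK' h h'

end ReflQuot
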